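/- Let q be a positive integer and a₁,…,a_r distinct residues mod q with gcd(a_j,q) = 1. Then Σ_{j=1}^r R(x,q,a_j) = κ·x^{1/2}/log x + O(x^{1/2}/(log x)²), where κ = (1/φ(q))·Σ_{j=1}^r #{b mod q : b² ≡ a_j (mod q)} and the implied constant depends on q. -/

import Mathlib

/-- The set of rational primes congruent to `a` mod `q`. -/
def residueClassPrimes (q : ℕ) (a : ZMod q) : Set ℕ :=
  {p | p.Prime ∧ (p : ZMod q) = a}

/-- The number of elements of a set `P` of natural numbers that are `≤ x`. -/
noncomputable def natCount (P : Set ℕ) (x : ℝ) : ℕ :=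
  Set.ncard {p | p ∈ P ∧ (p : ℝ) ≤ x}

/-- The prime counting function `π(x)`. -/
noncomputable def primePi (x : ℝ) : ℕ := natCount {p | p.Prime} x

/-- `f = Ω(g)`: `limsup |f|/g > 0`, i.e. there are `c > 0` and arbitrarily large `x`
with `|f x| ≥ c * g x`. -/
def IsOmega (f g : ℝ → ℝ) : Prop :=
  ∃ c > (0:ℝ), ∀ X : ℝ, ∃ x ≥ X, |f x| ≥ c * g x

open Filter Asymptotics

/-- `R(x,q,a) = Σ_{p^k ≤ x, p prime, k ≥ 2, p^k ≡ a (mod q)} 1/k`. -/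
noncomputable def Rqa (q : ℕ) (a : ZMod q) (x : ℝ) : ℝ :=
  ∑' p : ℕ, ∑' k : ℕ,
    if p.Prime ∧ 2 ≤ k ∧ (p : ℝ) ^ k ≤ x ∧ (p : ZMod q) ^ k = a then (1 : ℝ) / k else 0

namespace PrimesAP

open Complex Topology HurwitzZeta

/-- The difference between `v ^ (-s)` and the integral of `u ^ (-s)` over `[v, v + 1]`. -/
noncomputable def emTerm (v : ℝ) (s : ℂ) : ℂ :=
  (v : ℂ) ^ (-s) - (((v + 1 : ℝ) : ℂ) ^ (-s + 1) / (-s + 1) - (v : ℂ) ^ (-s + 1) / (-s + 1))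

lemma norm_cpow_sub_cpow_le {v u : ℝ} (hv : 0 < v) (hu : v ≤ u) {s : ℂ} (hs : 0 < s.re) :
    ‖(v : ℂ) ^ (-s) - (u : ℂ) ^ (-s)‖ ≤ ‖s‖ * v ^ (-s.re - 1) * (u - v) := by
  have hs0 : s ≠ 0 := by rintro rfl; simp at hs
  rw [norm_sub_rev]
  refine norm_image_sub_le_of_norm_deriv_le_segment' (f := fun y : ℝ => (y : ℂ) ^ (-s))
    (f' := fun y : ℝ => -s * (y : ℂ) ^ (-s - 1)) (a := v) (b := u) ?_ ?_ u ⟨hu, le_rfl⟩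
  · intro x hx
    have hx0 : 0 < x := hv.trans_le hx.1
    exact (hasDerivAt_ofReal_cpow_const hx0.ne' (neg_ne_zero.2 hs0)).hasDerivWithinAt
  · intro x hx
    have hx0 : 0 < x := hv.trans_le hx.1
    rw [norm_mul, norm_neg, Complex.norm_cpow_eq_rpow_re_of_pos hx0]
    simp only [sub_re, neg_re, one_re]
    gcongr ‖s‖ * ?_
    exact Real.rpow_le_rpow_of_nonpos hv hx.1 (by linarith)

lemma norm_emTerm_le {v : ℝ} (hv : 0 < v) {s : ℂ} (hs : 0 < s.re) (hs1 : s ≠ 1) :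
    ‖emTerm v s‖ ≤ ‖s‖ * v ^ (-s.re - 1) := by
  have h := norm_image_sub_le_of_norm_deriv_le_segment'
    (f := fun y : ℝ => (y : ℂ) * (v : ℂ) ^ (-s) - (y : ℂ) ^ (-s + 1) / (-s + 1))
    (f' := fun y : ℝ => (v : ℂ) ^ (-s) - (y : ℂ) ^ (-s)) (a := v) (b := v + 1)
    (C := ‖s‖ * v ^ (-s.re - 1)) ?_ ?_ (v + 1) ⟨by linarith, le_rfl⟩
  · simp only [add_sub_cancel_left, mul_one] at h
    convert h using 1
    congr 1
    rw [emTerm]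
    push_cast
    ring
  · intro x hx
    have hx0 : 0 < x := hv.trans_le hx.1
    have h1 : HasDerivAt (fun y : ℝ => (y : ℂ) * (v : ℂ) ^ (-s)) ((v : ℂ) ^ (-s)) x := by
      simpa using (Complex.ofRealCLM.hasDerivAt (x := x)).mul_const ((v : ℂ) ^ (-s))
    exact (h1.sub (hasDerivAt_ofReal_cpow_const' hx0.ne'
      (fun h => hs1 (neg_injective h)))).hasDerivWithinAt
  · intro x hx
    refine (norm_cpow_sub_cpow_le hv hx.1 hs).trans ?_
    have : x - v ≤ 1 := by linarith [hx.2]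
    have h0 : 0 ≤ ‖s‖ * v ^ (-s.re - 1) := by positivity
    nlinarith

lemma differentiableAt_emTerm {v : ℝ} (hv : 0 < v) {s : ℂ} (hs1 : s ≠ 1) :
    DifferentiableAt ℂ (emTerm v) s := by
  have h1 : -s + 1 ≠ 0 := fun h => hs1 (by linear_combination -h)
  have hv0 : (v : ℂ) ≠ 0 := by exact_mod_cast hv.ne'
  have hv1 : ((v + 1 : ℝ) : ℂ) ≠ 0 := by exact_mod_cast (by linarith : v + 1 ≠ 0)
  unfold emTerm
  refine DifferentiableAt.sub ?_ (DifferentiableAt.sub (DifferentiableAt.div ?_ ?_ h1)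
    (DifferentiableAt.div ?_ ?_ h1))
  · exact (by fun_prop : DifferentiableAt ℂ (fun s : ℂ => -s) s).const_cpow (.inl hv0)
  · exact (by fun_prop : DifferentiableAt ℂ (fun s : ℂ => -s + 1) s).const_cpow (.inl hv1)
  · fun_prop
  · exact (by fun_prop : DifferentiableAt ℂ (fun s : ℂ => -s + 1) s).const_cpow (.inl hv0)
  · fun_prop

lemma hasSum_emTerm {a : ℝ} (ha : 0 < a) (ha1 : a ≤ 1) {s : ℂ} (hs : 1 < s.re) (N : ℕ) :
    HasSum (fun n : ℕ => emTerm ((n + N : ℕ) + a) s)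
      (hurwitzZeta a s - ∑ n ∈ Finset.range N, (((n : ℝ) + a : ℝ) : ℂ) ^ (-s)
        + ((N + a : ℝ) : ℂ) ^ (-s + 1) / (-s + 1)) := by
  have h1 : HasSum (fun n : ℕ => (((n : ℝ) + a : ℝ) : ℂ) ^ (-s)) (hurwitzZeta a s) := by
    convert hasSum_hurwitzZeta_of_one_lt_re ⟨ha.le, ha1⟩ hs using 2 with n
    rw [cpow_neg]
    push_cast
    simp
  have h2 := (hasSum_nat_add_iff' N).2 h1
  set g : ℕ → ℂ := fun n => (((n + N : ℕ) + a : ℝ) : ℂ) ^ (-s + 1) / (-s + 1) with hg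
  have hlim : Tendsto g atTop (𝓝 0) := by
    rw [tendsto_zero_iff_norm_tendsto_zero]
    have : ∀ n, ‖g n‖ = (((n + N : ℕ) + a : ℝ)) ^ (-(s.re - 1)) / ‖-s + 1‖ := by
      intro n
      rw [hg]
      simp only [norm_div]
      rw [Complex.norm_cpow_eq_rpow_re_of_pos (by positivity)]
      simp only [add_re, neg_re, one_re]
      congr 2; ring
    simp_rw [this]
    rw [← zero_div ‖-s + 1‖]
    refine Tendsto.div_const ?_ _
    refine (tendsto_rpow_neg_atTop (by linarith : 0 < s.re - 1)).comp ?_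
    refine tendsto_atTop_add_const_right _ _ ?_
    exact tendsto_natCast_atTop_atTop.comp (tendsto_add_atTop_nat N)
  have hb : ∀ n : ℕ, 0 < (((n + N : ℕ) : ℝ) + a) := fun n => by positivity
  have key : ∀ n : ℕ, emTerm ((n + N : ℕ) + a) s =
      ((((n + N : ℕ) : ℝ) + a : ℝ) : ℂ) ^ (-s) - (g (n + 1) - g n) := by
    intro n
    simp only [emTerm, hg]
    have : ((n + 1 + N : ℕ) : ℝ) + a = (n + N : ℕ) + a + 1 := by push_cast; ring
    rw [this]
  have hs1 : s ≠ 1 := by rintro rfl; simp at hs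
  have hsum : Summable (fun n : ℕ => emTerm ((n + N : ℕ) + a) s) := by
    have hbase : Summable (fun n : ℕ => ‖s‖ * |((n + N : ℕ) : ℝ) + a| ^ (-s.re - 1)) := by
      refine Summable.mul_left _ ?_
      have := (Real.summable_one_div_nat_add_rpow a (s.re + 1)).2 (by linarith)
      have := (summable_nat_add_iff N).2 this
      refine this.congr fun n => ?_
      rw [one_div, ← Real.rpow_neg (abs_nonneg _)]
      congr 1; ring
    refine Summable.of_norm_bounded hbase fun n => ?_
    rw [abs_of_pos (hb n)]
    exact norm_emTerm_le (hb n) (by linarith) hs1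
  have htel : HasSum (fun n => g (n + 1) - g n) (0 - g 0) := by
    have hsm : Summable (fun n => g (n + 1) - g n) := by
      have := h2.summable.sub hsum
      refine this.congr fun n => ?_
      rw [key]
      ring
    rw [hsm.hasSum_iff_tendsto_nat]
    simp_rw [Finset.sum_range_sub]
    exact hlim.sub_const _
  have := h2.sub htel
  rw [funext key]
  convert! this using 1
  simp only [hg, zero_add, zero_sub, sub_neg_eq_add]

lemma summable_natCast_add_rpow (a : ℝ) {σ : ℝ} (hσ : 1 < σ) (N : ℕ) :
    Summable (fun n : ℕ => |((n + N : ℕ) : ℝ) + a| ^ (-σ)) := by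
  have := (summable_nat_add_iff N).2 ((Real.summable_one_div_nat_add_rpow a σ).2 hσ)
  refine this.congr fun n => ?_
  rw [one_div, ← Real.rpow_neg (abs_nonneg _)]

lemma hurwitzZeta_eq {a : ℝ} (ha : 0 < a) (ha1 : a ≤ 1) {s₀ : ℂ} (hs : 0 < s₀.re)
    (him : s₀.im ≠ 0) {N : ℕ} (hN : 1 ≤ N) :
    hurwitzZeta a s₀ - ∑ n ∈ Finset.range N, (((n : ℝ) + a : ℝ) : ℂ) ^ (-s₀)
        + ((N + a : ℝ) : ℂ) ^ (-s₀ + 1) / (-s₀ + 1) = ∑' n : ℕ, emTerm ((n + N : ℕ) + a) s₀ := by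
  set R := ‖s₀‖ + 3 with hR
  set U : Set ℂ := {s | s₀.re / 2 < s.re} ∩ {s | 0 < s₀.im * s.im} ∩ Metric.ball 0 R with hU
  have hUo : IsOpen U :=
    ((isOpen_lt continuous_const continuous_re).inter
      (isOpen_lt continuous_const (continuous_const.mul continuous_im))).inter Metric.isOpen_ball
  have hUc : Convex ℝ U := by
    refine ((convex_halfSpace_re_gt _).inter ?_).inter (convex_ball _ _)
    intro x hx y hy a b ha hb hab
    simp only [Set.mem_ofPred_eq] at hx hy ⊢
    simp only [add_im, real_smul, mul_im, ofReal_re, ofReal_im, zero_mul, add_zero]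
    rcases ha.eq_or_lt with rfl | ha'
    · have : b = 1 := by linarith
      subst this; simpa using hy
    · nlinarith [mul_pos ha' hx, mul_nonneg hb hy.le]
  have hU1 : ∀ s ∈ U, s ≠ 1 := by
    rintro s ⟨⟨_, h⟩, _⟩ rfl
    simp at h
  have hv : ∀ n : ℕ, 1 ≤ ((n + N : ℕ) : ℝ) + a := fun n => by
    have : (1 : ℝ) ≤ ((n + N : ℕ) : ℝ) := by exact_mod_cast (by omega)
    linarith
  have hva : ∀ n : ℕ, (0 : ℝ) < n + a := fun n => by positivity
  have hmem₀ : s₀ ∈ U := by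
    refine ⟨⟨?_, ?_⟩, ?_⟩
    · simp only [Set.mem_ofPred_eq]; linarith
    · exact mul_self_pos.2 him
    · simp [hR]
  have hmem₁ : (2 + s₀.im * I : ℂ) ∈ U ∨ s₀.re / 2 ≥ 2 := by
    by_cases h : s₀.re / 2 < 2
    · left
      refine ⟨⟨?_, ?_⟩, ?_⟩
      · simpa using h
      · simpa using mul_self_pos.2 him
      · rw [mem_ball_zero_iff]
        calc ‖(2 + s₀.im * I : ℂ)‖ ≤ ‖(2 : ℂ)‖ + ‖(s₀.im * I : ℂ)‖ := norm_add_le _ _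
          _ ≤ 2 + ‖s₀‖ := by
            gcongr
            · simp
            · simpa using abs_im_le_norm s₀
          _ < R := by rw [hR]; linarith
    · right; linarith
  rcases hmem₁ with hmem₁ | hbig
  swap
  · exact (hasSum_emTerm ha ha1 (by linarith) N).tsum_eq.symm
  have hd1 : DifferentiableOn ℂ (fun s => hurwitzZeta a s
      - ∑ n ∈ Finset.range N, (((n : ℝ) + a : ℝ) : ℂ) ^ (-s)
        + ((N + a : ℝ) : ℂ) ^ (-s + 1) / (-s + 1)) U := by
    intro s hs
    refine DifferentiableAt.differentiableWithinAt ?_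
    refine ((differentiableAt_hurwitzZeta _ (hU1 s hs)).sub ?_).add (DifferentiableAt.div ?_ ?_ ?_)
    · refine DifferentiableAt.fun_sum fun n _ => ?_
      exact (by fun_prop : DifferentiableAt ℂ (fun s : ℂ => -s) s).const_cpow
        (.inl (by exact_mod_cast (hva n).ne'))
    · exact (by fun_prop : DifferentiableAt ℂ (fun s : ℂ => -s + 1) s).const_cpow
        (.inl (by exact_mod_cast (hva N).ne'))
    · fun_prop
    · exact fun h => hU1 s hs (by linear_combination -h)
  have hd2 : DifferentiableOn ℂ (fun s => ∑' n : ℕ, emTerm ((n + N : ℕ) + a) s) U := by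
    refine differentiableOn_tsum_of_summable_norm
      (u := fun n : ℕ => R * |((n + N : ℕ) : ℝ) + a| ^ (-(s₀.re / 2 + 1)))
      ((summable_natCast_add_rpow a (by linarith) N).mul_left _) ?_ hUo ?_
    · intro n s hs
      exact (differentiableAt_emTerm (by linarith [hv n]) (hU1 s hs)).differentiableWithinAt
    · intro n s hs
      have h1 : s₀.re / 2 < s.re := hs.1.1
      refine (norm_emTerm_le (by linarith [hv n]) (by linarith) (hU1 s hs)).trans ?_
      rw [abs_of_nonneg (by linarith [hv n])]
      have h2 : ‖s‖ ≤ R := (mem_ball_zero_iff.1 hs.2).le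
      have h3 : (((n + N : ℕ) : ℝ) + a) ^ (-s.re - 1)
          ≤ (((n + N : ℕ) : ℝ) + a) ^ (-(s₀.re / 2 + 1)) :=
        Real.rpow_le_rpow_of_exponent_le (hv n) (by linarith)
      have h4 : 0 ≤ (((n + N : ℕ) : ℝ) + a) ^ (-s.re - 1) :=
        Real.rpow_nonneg (by linarith [hv n]) _
      gcongr
  refine (hd1.analyticOnNhd hUo).eqOn_of_preconnected_of_eventuallyEq (hd2.analyticOnNhd hUo)
    hUc.isPreconnected hmem₁ ?_ hmem₀
  filter_upwards [(isOpen_lt continuous_const continuous_re).mem_nhds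
    (show (2 + s₀.im * I : ℂ) ∈ {s : ℂ | 1 < s.re} by simp)] with s hs
  exact (hasSum_emTerm ha ha1 hs N).tsum_eq.symm

/-- Polynomial growth of the Hurwitz zeta function, with a small exponent, in a half plane slightly
larger than `1 ≤ re s`. -/
theorem norm_hurwitzZeta_le {a : ℝ} (ha : 0 < a) (ha1 : a ≤ 1) {δ : ℝ} (hδ : 0 < δ)
    (hδ1 : δ ≤ 1 / 2) :
    ∃ C > 0, ∀ s : ℂ, 1 - δ ≤ s.re → s.re ≤ 3 → 1 ≤ |s.im| →
      ‖hurwitzZeta a s‖ ≤ C * |s.im| ^ (2 * δ) := by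
  have hsumm : Summable (fun n : ℕ => ((n : ℝ) + a) ^ (-(1 + δ))) := by
    refine (summable_natCast_add_rpow a (by linarith : 1 < 1 + δ) 0).congr fun n => ?_
    rw [abs_of_pos (by positivity)]; simp
  set B := ∑' n : ℕ, ((n : ℝ) + a) ^ (-(1 + δ)) with hB
  have hBnn : 0 ≤ B := tsum_nonneg fun n => by positivity
  have ha3 : 1 ≤ a ^ (-3 : ℝ) := Real.one_le_rpow_of_pos_of_le_one_of_nonpos ha ha1 (by norm_num)
  refine ⟨a ^ (-3 : ℝ) + 3 * B + 3 + 4 * B, by positivity, fun s h1 h3 him => ?_⟩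
  set T := |s.im| with hT
  set N := ⌈T⌉₊ with hN
  have hTN : T ≤ N := Nat.le_ceil _
  have hNT : (N : ℝ) ≤ T + 1 := (Nat.ceil_lt_add_one (by linarith)).le
  have hN1 : 1 ≤ N := by exact_mod_cast him.trans hTN
  have hsre : 0 < s.re := by linarith
  have him0 : s.im ≠ 0 := by intro h; rw [hT, h] at him; norm_num at him
  have hs1 : s ≠ 1 := by rintro rfl; simp at him0
  have hTpos : 0 < T := by linarith
  have hT1 : 1 ≤ T ^ (2 * δ) := Real.one_le_rpow him (by linarith)
  have hNaT : ((N : ℝ) + a) ^ (2 * δ) ≤ 3 * T ^ (2 * δ) := by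
    calc ((N : ℝ) + a) ^ (2 * δ) ≤ (3 * T) ^ (2 * δ) :=
          Real.rpow_le_rpow (by positivity) (by linarith) (by linarith)
      _ = 3 ^ (2 * δ) * T ^ (2 * δ) := Real.mul_rpow (by norm_num) (by linarith)
      _ ≤ 3 * T ^ (2 * δ) := by
          gcongr
          calc (3 : ℝ) ^ (2 * δ) ≤ 3 ^ (1 : ℝ) :=
                Real.rpow_le_rpow_of_exponent_le (by norm_num) (by linarith)
            _ = 3 := Real.rpow_one 3
  have hmain : ‖∑ n ∈ Finset.range N, (((n : ℝ) + a : ℝ) : ℂ) ^ (-s)‖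
      ≤ (a ^ (-3 : ℝ) + 3 * B) * T ^ (2 * δ) := by
    calc _ ≤ ∑ n ∈ Finset.range N, ‖(((n : ℝ) + a : ℝ) : ℂ) ^ (-s)‖ := norm_sum_le _ _
      _ = ∑ n ∈ Finset.range N, ((n : ℝ) + a) ^ (-s.re) := by
          refine Finset.sum_congr rfl fun n _ => ?_
          rw [Complex.norm_cpow_eq_rpow_re_of_pos (by positivity), neg_re]
      _ ≤ ∑ n ∈ Finset.range N, ((if n = 0 then a ^ (-3 : ℝ) else 0)
            + ((N : ℝ) + a) ^ (2 * δ) * ((n : ℝ) + a) ^ (-(1 + δ))) := by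
          refine Finset.sum_le_sum fun n hn => ?_
          have hnN : (n : ℝ) ≤ N := by exact_mod_cast (Finset.mem_range.1 hn).le
          split_ifs with h0
          · subst h0
            have : a ^ (-s.re) ≤ a ^ (-3 : ℝ) :=
              Real.rpow_le_rpow_of_exponent_ge ha ha1 (by linarith)
            have : 0 ≤ ((N : ℝ) + a) ^ (2 * δ) * (((0 : ℕ) : ℝ) + a) ^ (-(1 + δ)) := by positivity
            simp only [Nat.cast_zero, zero_add] at *
            linarith
          · have hn1 : (1 : ℝ) ≤ n := by exact_mod_cast Nat.one_le_iff_ne_zero.2 h0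
            rw [zero_add]
            calc ((n : ℝ) + a) ^ (-s.re) ≤ ((n : ℝ) + a) ^ (2 * δ + -(1 + δ)) :=
                  Real.rpow_le_rpow_of_exponent_le (by linarith) (by linarith)
              _ = ((n : ℝ) + a) ^ (2 * δ) * ((n : ℝ) + a) ^ (-(1 + δ)) :=
                  Real.rpow_add (by positivity) _ _
              _ ≤ _ := by gcongr
      _ ≤ a ^ (-3 : ℝ) + ((N : ℝ) + a) ^ (2 * δ) * B := by
          rw [Finset.sum_add_distrib, ← Finset.mul_sum]
          gcongr
          · rw [Finset.sum_ite_eq' (Finset.range N) 0 (fun _ => a ^ (-3 : ℝ))]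
            split_ifs
            · exact le_rfl
            · positivity
          · exact hsumm.sum_le_tsum _ fun n _ => by positivity
      _ ≤ a ^ (-3 : ℝ) * T ^ (2 * δ) + (3 * T ^ (2 * δ)) * B := by
          gcongr
          exact le_mul_of_one_le_right (by positivity) hT1
      _ = _ := by ring
  have hmid : ‖((N + a : ℝ) : ℂ) ^ (-s + 1) / (-s + 1)‖ ≤ 3 * T ^ (2 * δ) := by
    rw [norm_div, Complex.norm_cpow_eq_rpow_re_of_pos (by positivity)]
    have hden : 1 ≤ ‖-s + 1‖ := by
      calc (1 : ℝ) ≤ |(-s + 1).im| := by simpa using him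
        _ ≤ _ := abs_im_le_norm _
    refine (div_le_self (by positivity) hden).trans (le_trans ?_ hNaT)
    have hN1' : (1 : ℝ) ≤ N := by exact_mod_cast hN1
    refine Real.rpow_le_rpow_of_exponent_le (by linarith) ?_
    simp only [add_re, neg_re, one_re]; linarith
  have htail : ‖∑' n : ℕ, emTerm ((n + N : ℕ) + a) s‖ ≤ 4 * B * T ^ (2 * δ) := by
    have hsn : ‖s‖ ≤ 4 * T := by
      calc ‖s‖ ≤ |s.re| + |s.im| := norm_le_abs_re_add_abs_im s
        _ ≤ 3 + T := by gcongr; rw [abs_of_pos hsre]; exact h3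
        _ ≤ 4 * T := by linarith
    have hsh : Summable (fun n : ℕ => (((n + N : ℕ) : ℝ) + a) ^ (-(1 + δ))) :=
      (summable_nat_add_iff N).2 hsumm
    have hbd : ∀ n : ℕ, ‖emTerm ((n + N : ℕ) + a) s‖
        ≤ (4 * T * T ^ (2 * δ - 1)) * (((n + N : ℕ) : ℝ) + a) ^ (-(1 + δ)) := by
      intro n
      have hv : T ≤ ((n + N : ℕ) : ℝ) + a := by push_cast; linarith [(Nat.cast_nonneg n : (0:ℝ) ≤ n)]
      have hv0 : 0 < ((n + N : ℕ) : ℝ) + a := by linarith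
      refine (norm_emTerm_le hv0 hsre hs1).trans ?_
      rw [mul_assoc (4 * T)]
      gcongr
      calc (((n + N : ℕ) : ℝ) + a) ^ (-s.re - 1)
          ≤ (((n + N : ℕ) : ℝ) + a) ^ ((2 * δ - 1) + -(1 + δ)) :=
            Real.rpow_le_rpow_of_exponent_le (by linarith) (by linarith)
        _ = (((n + N : ℕ) : ℝ) + a) ^ (2 * δ - 1) * (((n + N : ℕ) : ℝ) + a) ^ (-(1 + δ)) :=
            Real.rpow_add hv0 _ _
        _ ≤ T ^ (2 * δ - 1) * (((n + N : ℕ) : ℝ) + a) ^ (-(1 + δ)) := by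
            have := Real.rpow_le_rpow_of_nonpos hTpos hv (by linarith : 2 * δ - 1 ≤ 0)
            gcongr
    have hTT : 4 * T * T ^ (2 * δ - 1) = 4 * T ^ (2 * δ) := by
      rw [mul_assoc]
      congr 1
      conv_lhs => rw [← Real.rpow_one T, ← Real.rpow_mul (by linarith), one_mul]
      rw [← Real.rpow_add (by linarith)]
      congr 1; ring
    refine (tsum_of_norm_bounded (hsh.mul_left _).hasSum hbd).trans ?_
    rw [tsum_mul_left, hTT]
    have : ∑' n : ℕ, (((n + N : ℕ) : ℝ) + a) ^ (-(1 + δ)) ≤ B := by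
      rw [hB, ← hsumm.sum_add_tsum_nat_add N]
      have : 0 ≤ ∑ n ∈ Finset.range N, ((n : ℝ) + a) ^ (-(1 + δ)) :=
        Finset.sum_nonneg fun n _ => by positivity
      linarith
    calc _ ≤ 4 * T ^ (2 * δ) * B := by gcongr
      _ = _ := by ring
  have heq := hurwitzZeta_eq ha ha1 hsre him0 hN1
  have : hurwitzZeta a s = ∑ n ∈ Finset.range N, (((n : ℝ) + a : ℝ) : ℂ) ^ (-s)
      - ((N + a : ℝ) : ℂ) ^ (-s + 1) / (-s + 1) + ∑' n : ℕ, emTerm ((n + N : ℕ) + a) s := by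
    linear_combination heq
  rw [this]
  calc _ ≤ _ := (norm_add_le _ _).trans (add_le_add_left (norm_sub_le _ _) _)
    _ ≤ (a ^ (-3 : ℝ) + 3 * B) * T ^ (2 * δ) + 3 * T ^ (2 * δ) + 4 * B * T ^ (2 * δ) := by
        gcongr
    _ = _ := by ring

lemma exists_toAddCircle_eq {N : ℕ} [NeZero N] (j : ZMod N) :
    ∃ a : ℝ, 0 < a ∧ a ≤ 1 ∧ ZMod.toAddCircle j = (a : UnitAddCircle) := by
  rcases eq_or_ne j 0 with rfl | hj
  · refine ⟨1, one_pos, le_rfl, ?_⟩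
    rw [map_zero]
    exact (AddCircle.coe_period 1).symm
  · have hN : (0 : ℝ) < N := by exact_mod_cast NeZero.pos N
    have hv : 0 < j.val := Nat.pos_of_ne_zero (by rwa [Ne, ZMod.val_eq_zero])
    refine ⟨(j.val : ℝ) / N, by positivity, ?_, ZMod.toAddCircle_apply j⟩
    rw [div_le_one hN]
    exact_mod_cast (ZMod.val_lt j).le

lemma norm_LFunction_le {N : ℕ} [NeZero N] (χ : DirichletCharacter ℂ N) {δ : ℝ} (hδ : 0 < δ)
    (hδ1 : δ ≤ 1 / 2) :
    ∃ C > 0, ∀ s : ℂ, 1 - δ ≤ s.re → s.re ≤ 3 → 1 ≤ |s.im| →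
      ‖χ.LFunction s‖ ≤ C * |s.im| ^ (2 * δ) := by
  have h (j : ZMod N) : ∃ C > 0, ∀ s : ℂ, 1 - δ ≤ s.re → s.re ≤ 3 → 1 ≤ |s.im| →
      ‖hurwitzZeta (ZMod.toAddCircle j) s‖ ≤ C * |s.im| ^ (2 * δ) := by
    obtain ⟨a, ha, ha1, hj⟩ := exists_toAddCircle_eq j
    rw [hj]
    exact norm_hurwitzZeta_le ha ha1 hδ hδ1
  choose C hC hb using h
  refine ⟨∑ j, C j, Finset.sum_pos (fun j _ => hC j) Finset.univ_nonempty, fun s h1 h2 h3 => ?_⟩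
  have hN : (0 : ℝ) < N := by exact_mod_cast NeZero.pos N
  have hN1 : (1 : ℝ) ≤ N := by exact_mod_cast NeZero.pos N
  rw [DirichletCharacter.LFunction, ZMod.LFunction, norm_mul]
  have hNs : ‖(N : ℂ) ^ (-s)‖ ≤ 1 := by
    rw [Complex.norm_natCast_cpow_of_pos (NeZero.pos N), neg_re]
    exact Real.rpow_le_one_of_one_le_of_nonpos hN1 (by linarith)
  refine (mul_le_of_le_one_left (norm_nonneg _) hNs).trans ?_
  rw [Finset.sum_mul]
  refine norm_sum_le_of_le _ fun j _ => ?_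
  rw [norm_mul]
  exact (mul_le_of_le_one_left (norm_nonneg _) (χ.norm_le_one j)).trans (hb j s h1 h2 h3)

lemma norm_LFunction_deriv_le {N : ℕ} [NeZero N] (χ : DirichletCharacter ℂ N) {ε : ℝ}
    (hε : 0 < ε) (hε1 : ε ≤ 1) :
    ∃ A > 0, ∀ s : ℂ, 1 - ε / 4 ≤ s.re → s.re ≤ 2 → 2 ≤ |s.im| →
      ‖χ.LFunction s‖ ≤ A * |s.im| ^ ε ∧ ‖deriv χ.LFunction s‖ ≤ A * |s.im| ^ ε := by
  obtain ⟨C, hC, hb⟩ := norm_LFunction_le χ (half_pos hε) (by linarith : ε / 2 ≤ 1 / 2)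
  rw [mul_div_cancel₀ _ (two_ne_zero)] at hb
  refine ⟨8 * C / ε, by positivity, fun s h1 h2 h3 => ?_⟩
  have hT : 0 < |s.im| := by linarith
  constructor
  · refine (hb s (by linarith) (by linarith) (by linarith)).trans ?_
    gcongr
    rw [le_div_iff₀ hε]
    nlinarith
  · have key := Complex.norm_deriv_le_of_forall_mem_sphere_norm_le (f := χ.LFunction) (c := s)
      (R := ε / 4) (C := 2 * C * |s.im| ^ ε) (by positivity) ?_ ?_
    · refine key.trans (le_of_eq ?_)
      field_simp
      norm_num
    · apply DifferentiableOn.diffContOnCl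
      intro z hz
      rw [closure_ball _ (by positivity), Metric.mem_closedBall, dist_eq_norm] at hz
      refine (χ.differentiableAt_LFunction z (Or.inl ?_)).differentiableWithinAt
      rintro rfl
      have := (abs_im_le_norm _).trans hz
      simp at this
      linarith
    · intro z hz
      rw [mem_sphere_iff_norm] at hz
      have him := (abs_im_le_norm _).trans hz.le
      have hre := (abs_re_le_norm _).trans hz.le
      rw [sub_re] at hre
      rw [sub_im] at him
      rw [abs_le] at hre
      have h4 := abs_sub_abs_le_abs_sub s.im z.im
      have h5 := abs_sub_abs_le_abs_sub z.im s.im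
      rw [abs_sub_comm] at h4
      refine (hb z (by linarith) (by linarith) (by linarith)).trans ?_
      have : |z.im| ^ ε ≤ 2 * |s.im| ^ ε := by
        calc |z.im| ^ ε ≤ (2 * |s.im|) ^ ε := by gcongr; linarith
          _ = 2 ^ ε * |s.im| ^ ε := Real.mul_rpow (by norm_num) (by positivity)
          _ ≤ 2 * |s.im| ^ ε := by
            gcongr
            calc (2 : ℝ) ^ ε ≤ 2 ^ (1 : ℝ) := Real.rpow_le_rpow_of_exponent_le (by norm_num) hε1
              _ = 2 := Real.rpow_one 2
      nlinarith

lemma norm_LFunctionTrivChar_le (N : ℕ) [NeZero N] :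
    ∃ C > 0, ∀ x : ℝ, 0 < x → x ≤ 1 →
      ‖DirichletCharacter.LFunctionTrivChar N (1 + x)‖ ≤ C / x := by
  have hc : Continuous fun x : ℝ => ‖DirichletCharacter.LFunctionTrivChar₁ N (1 + x)‖ :=
    ((DirichletCharacter.differentiable_LFunctionTrivChar₁ N).continuous.comp
      (by fun_prop)).norm
  obtain ⟨M, hM⟩ := isCompact_Icc.exists_bound_of_continuousOn
    (s := Set.Icc (0 : ℝ) 1) hc.continuousOn
  refine ⟨|M| + 1, by positivity, fun x h0 h1 => ?_⟩
  have h := hM x ⟨h0.le, h1⟩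
  rw [norm_norm] at h
  have hne : (1 + x : ℂ) ≠ 1 := by
    intro h; simp at h; exact h0.ne' h
  rw [DirichletCharacter.LFunctionTrivChar₁, Function.update_of_ne hne, norm_mul] at h
  simp only [add_sub_cancel_left, norm_real, Real.norm_eq_abs, abs_of_pos h0] at h
  rw [le_div_iff₀ h0]
  linarith [le_abs_self M]

lemma le_norm_LFunction {N : ℕ} [NeZero N] (χ : DirichletCharacter ℂ N) {ε : ℝ}
    (hε : 0 < ε) (hε1 : ε ≤ 1) :
    ∃ A > 0, ∀ t : ℝ, 2 ≤ |t| → ∀ y : ℝ, 0 < y → y ≤ 1 →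
      y ^ 3 / (A * |t| ^ ε) ≤ ‖χ.LFunction (1 + (y ^ 4 : ℝ) + I * t)‖ := by
  obtain ⟨A₂, hA₂, h₂⟩ := norm_LFunction_deriv_le (χ ^ 2) hε hε1
  obtain ⟨A₃, hA₃, h₃⟩ := norm_LFunctionTrivChar_le N
  refine ⟨2 * A₂ + A₃, by positivity, fun t ht y hy hy1 => ?_⟩
  have hE1 : 1 ≤ |t| ^ ε := Real.one_le_rpow (by linarith) hε.le
  have hy4 : 0 < y ^ 4 := by positivity
  have hy41 : y ^ 4 ≤ 1 := pow_le_one₀ hy.le hy1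
  have hp := χ.norm_LFunction_product_ge_one hy4 t
  rw [norm_mul, norm_mul, norm_pow, norm_pow] at hp
  have e1 : ‖DirichletCharacter.LFunctionTrivChar N (1 + (y ^ 4 : ℝ))‖ ≤ (2 * A₂ + A₃) / y ^ 4 :=
    (h₃ _ hy4 hy41).trans (by gcongr; linarith)
  have e2 : ‖(χ ^ 2).LFunction (1 + (y ^ 4 : ℝ) + 2 * I * t)‖ ≤ (2 * A₂ + A₃) * |t| ^ ε := by
    have h4 : |2 * t| = 2 * |t| := by rw [abs_mul, abs_two]
    have e3 : (1 + (y ^ 4 : ℝ) + 2 * I * t : ℂ).im = 2 * t := by simp [-ofReal_pow]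
    have e4 : (1 + (y ^ 4 : ℝ) + 2 * I * t : ℂ).re = 1 + y ^ 4 := by simp [-ofReal_pow]
    have := (h₂ (1 + (y ^ 4 : ℝ) + 2 * I * t) (by rw [e4]; linarith)
      (by rw [e4]; linarith) (by rw [e3, h4]; linarith)).1
    refine this.trans ?_
    rw [e3, h4, Real.mul_rpow (by norm_num) (by positivity)]
    have : (2 : ℝ) ^ ε ≤ 2 := by
      calc (2 : ℝ) ^ ε ≤ 2 ^ (1 : ℝ) := Real.rpow_le_rpow_of_exponent_le (by norm_num) hε1
        _ = 2 := Real.rpow_one 2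
    calc A₂ * (2 ^ ε * |t| ^ ε) ≤ A₂ * (2 * |t| ^ ε) := by gcongr
      _ = 2 * A₂ * |t| ^ ε := by ring
      _ ≤ (2 * A₂ + A₃) * |t| ^ ε := by gcongr; linarith
  generalize |t| ^ ε = E at *
  have hL0 := norm_nonneg (χ.LFunction (1 + (y ^ 4 : ℝ) + I * t))
  generalize ‖χ.LFunction (1 + (y ^ 4 : ℝ) + I * t)‖ = L at *
  have hA : 0 < 2 * A₂ + A₃ := by positivity
  generalize 2 * A₂ + A₃ = A at *
  have hL : 1 ≤ (A / y ^ 4) ^ 3 * L ^ 4 * (A * E) := by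
    refine hp.trans ?_
    gcongr
  have h5 : (y ^ 3 / (A * E)) ^ 4 ≤ L ^ 4 := by
    rw [div_pow, div_le_iff₀ (by positivity)]
    have : (A / y ^ 4) ^ 3 * L ^ 4 * (A * E) * y ^ 12 = L ^ 4 * (A ^ 4 * E) := by
      field_simp
    have hEE : E ≤ E ^ 4 := le_self_pow₀ hE1 (by norm_num)
    calc (y ^ 3) ^ 4 = 1 * y ^ 12 := by ring
      _ ≤ (A / y ^ 4) ^ 3 * L ^ 4 * (A * E) * y ^ 12 := by gcongr
      _ = L ^ 4 * (A ^ 4 * E) := this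
      _ ≤ L ^ 4 * (A ^ 4 * E ^ 4) := by gcongr
      _ = _ := by ring
  exact le_of_pow_le_pow_left₀ (by norm_num) hL0 h5

lemma norm_logDeriv_LFunction_le {N : ℕ} [NeZero N] (χ : DirichletCharacter ℂ N) {ε : ℝ}
    (hε : 0 < ε) (hε1 : ε ≤ 1) :
    ∃ c > 0, c ≤ 1 ∧ ∃ C > 0, ∀ s : ℂ, 2 ≤ |s.im| → 1 - c / (|s.im| ^ ε) ^ 8 ≤ s.re →
      s.re ≤ 2 → χ.LFunction s ≠ 0 ∧
        ‖deriv χ.LFunction s / χ.LFunction s‖ ≤ C * (|s.im| ^ ε) ^ 8 := by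
  obtain ⟨A₁, hA₁, h₁⟩ := norm_LFunction_deriv_le χ hε hε1
  obtain ⟨A₂, hA₂, h₂⟩ := le_norm_LFunction χ hε hε1
  obtain ⟨A, hA1, hAA₁, hAA₂, hAε⟩ : ∃ A, 1 ≤ A ∧ A₁ ≤ A ∧ A₂ ≤ A ∧ 1 ≤ A * ε := by
    have hi : 0 < 1 / ε := by positivity
    refine ⟨A₁ + A₂ + 1 + 1 / ε, by linarith, by linarith, by linarith, ?_⟩
    rw [add_mul, one_div_mul_cancel hε.ne']
    have : 0 ≤ (A₁ + A₂ + 1) * ε := by positivity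
    linarith
  have hA0 : 0 < A := by linarith
  refine ⟨1 / (256 * A ^ 8), by positivity, ?_, 128 * A ^ 8, by positivity, ?_⟩
  · rw [div_le_one (by positivity)]
    linarith [one_le_pow₀ hA1 (n := 8)]
  intro s ht hs hs2
  have hE1 : 1 ≤ |s.im| ^ ε := Real.one_le_rpow (by linarith) hε.le
  replace h₁ (w : ℂ) (hw : w.im = s.im) (h : 1 - ε / 4 ≤ w.re) (h' : w.re ≤ 2) :
      ‖deriv χ.LFunction w‖ ≤ A * |s.im| ^ ε := by
    have := (h₁ w h h' (by rwa [hw])).2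
    rw [hw] at this
    exact this.trans (by gcongr)
  have low (y : ℝ) (hy : 0 < y) (hy1 : y ≤ 1) :
      y ^ 3 / (A * |s.im| ^ ε) ≤ ‖χ.LFunction (1 + (y ^ 4 : ℝ) + I * s.im)‖ :=
    le_trans (by gcongr) (h₂ s.im ht y hy hy1)
  clear h₂ hA₁ hA₂
  generalize |s.im| ^ ε = E at *
  have hE0 : 0 < E := by linarith
  obtain ⟨y, hy⟩ : ∃ y, y = 1 / (4 * A ^ 2 * E ^ 2) := ⟨_, rfl⟩
  have hy0 : 0 < y := by rw [hy]; positivity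
  have hy1 : y ≤ 1 := by
    rw [hy, div_le_one (by positivity)]
    nlinarith [one_le_pow₀ hA1 (n := 2), one_le_pow₀ hE1 (n := 2)]
  have hyv : y ^ 3 / (A * E) = 1 / (64 * A ^ 7 * E ^ 7) := by
    rw [hy]; field_simp; norm_num
  have hc8 : 1 / (256 * A ^ 8) / E ^ 8 ≤ ε / 4 := by
    rw [div_div, div_le_iff₀ (by positivity)]
    have h8 : A ≤ A ^ 8 * E ^ 8 := by
      calc A = A * 1 := by ring
        _ ≤ A ^ 8 * E ^ 8 := by
          gcongr
          · exact le_self_pow₀ hA1 (by norm_num)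
          · exact one_le_pow₀ hE1
    nlinarith
  have hlow : 1 / (128 * A ^ 7 * E ^ 7) ≤ ‖χ.LFunction s‖ := by
    rcases le_total (1 + y ^ 4) s.re with hge | hle
    · obtain ⟨x, hx⟩ : ∃ x, x = s.re - 1 := ⟨_, rfl⟩
      have hx0 : 0 < x := by have : 0 < y ^ 4 := by positivity
                             linarith
      obtain ⟨y', hy'⟩ : ∃ y', y' = x ^ (1 / 4 : ℝ) := ⟨_, rfl⟩
      have hy'4 : y' ^ 4 = x := by
        rw [hy', ← Real.rpow_natCast, ← Real.rpow_mul hx0.le]; norm_num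
      have hy'0 : 0 < y' := by rw [hy']; positivity
      have hyy : y ≤ y' := le_of_pow_le_pow_left₀ (n := 4) (by norm_num) hy'0.le
        (by rw [hy'4]; linarith)
      have hy'1 : y' ≤ 1 := hy' ▸ Real.rpow_le_one hx0.le (by linarith) (by norm_num)
      have h6 := low y' hy'0 hy'1
      have h7 : (1 + (y' ^ 4 : ℝ) + I * s.im : ℂ) = s := by
        rw [hy'4, hx]; apply Complex.ext <;> simp
      rw [h7] at h6
      refine le_trans ?_ h6
      calc 1 / (128 * A ^ 7 * E ^ 7) ≤ 1 / (64 * A ^ 7 * E ^ 7) := by gcongr; norm_num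
        _ = y ^ 3 / (A * E) := hyv.symm
        _ ≤ y' ^ 3 / (A * E) := by gcongr
    · have h6 := low y hy0 hy1
      set z : ℂ := 1 + (y ^ 4 : ℝ) + I * s.im with hz
      have hzre : z.re = 1 + y ^ 4 := by simp [hz, -ofReal_pow]
      have hzim : z.im = s.im := by simp [hz, -ofReal_pow]
      have hy41 : y ^ 4 ≤ 1 := pow_le_one₀ hy0.le hy1
      have hseg : ∀ w ∈ segment ℝ s z, w.im = s.im ∧ s.re ≤ w.re ∧ w.re ≤ 1 + y ^ 4 := by
        rintro w ⟨a, b, ha, hb, hab, rfl⟩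
        simp only [add_im, real_smul, mul_im, ofReal_re, ofReal_im, zero_mul, add_zero, add_re,
          mul_re, sub_zero, hzre, hzim]
        refine ⟨by rw [← add_mul, hab, one_mul], ?_, ?_⟩
        · nlinarith
        · nlinarith
      have hmv := (convex_segment s z).norm_image_sub_le_of_norm_deriv_le (𝕜 := ℂ)
        (f := χ.LFunction) (C := A * E) ?_ ?_ (left_mem_segment ℝ s z) (right_mem_segment ℝ s z)
      · have hsz : ‖z - s‖ = 1 + y ^ 4 - s.re := by
          have : z - s = ((1 + y ^ 4 - s.re : ℝ) : ℂ) := by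
            apply Complex.ext <;> simp [hz, -ofReal_pow]
          rw [this, norm_real, Real.norm_eq_abs, abs_of_nonneg (by linarith)]
        have h8 : ‖z - s‖ ≤ y ^ 4 + 1 / (256 * A ^ 8) / E ^ 8 := by rw [hsz]; linarith
        have h9 : ‖χ.LFunction z‖ ≤ ‖χ.LFunction s‖ + ‖χ.LFunction z - χ.LFunction s‖ := by
          have := norm_add_le (χ.LFunction s) (χ.LFunction z - χ.LFunction s)
          rwa [add_sub_cancel] at this
        have h10 : A * E * (y ^ 4 + 1 / (256 * A ^ 8) / E ^ 8) = 1 / (128 * A ^ 7 * E ^ 7) := by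
          rw [hy]; field_simp; norm_num
        have h11 : A * E * ‖z - s‖ ≤ 1 / (128 * A ^ 7 * E ^ 7) := by
          rw [← h10]; gcongr
        have h12 : 1 / (64 * A ^ 7 * E ^ 7) = 2 * (1 / (128 * A ^ 7 * E ^ 7)) := by
          field_simp; norm_num
        linarith
      · intro w hw
        refine χ.differentiableAt_LFunction w (Or.inl ?_)
        rintro rfl
        have := (hseg _ hw).1
        rw [← this] at ht
        simp at ht
        linarith
      · intro w hw
        obtain ⟨g1, g2, g3⟩ := hseg w hw
        exact h₁ w g1 (by linarith) (by linarith)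
  have hpos : 0 < ‖χ.LFunction s‖ := lt_of_lt_of_le (by positivity) hlow
  refine ⟨norm_pos_iff.1 hpos, ?_⟩
  rw [norm_div, div_le_iff₀ hpos]
  calc ‖deriv χ.LFunction s‖ ≤ A * E :=
        h₁ s rfl (by linarith) hs2
    _ = 128 * A ^ 8 * E ^ 8 * (1 / (128 * A ^ 7 * E ^ 7)) := by field_simp
    _ ≤ _ := by gcongr

/-- A function that is analytic and polynomially bounded, with exponent `η`, in a region to the
left of the line `re s = 1` whose width decays polynomially with exponent `η`. -/
def PolyBounded (η : ℝ) (f : ℂ → ℂ) : Prop :=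
  ∃ c > 0, c ≤ 1 ∧ ∃ C > 0, ∀ s : ℂ, 1 - c * (1 + |s.im|) ^ (-η) ≤ s.re → s.re ≤ 2 →
    AnalyticAt ℂ f s ∧ ‖f s‖ ≤ C * (1 + |s.im|) ^ η

lemma PolyBounded.add {η : ℝ} {f g : ℂ → ℂ} (hf : PolyBounded η f) (hg : PolyBounded η g) :
    PolyBounded η (fun s => f s + g s) := by
  obtain ⟨c, hc, hc1, C, hC, h⟩ := hf
  obtain ⟨d, hd, hd1, D, hD, k⟩ := hg
  refine ⟨min c d, lt_min hc hd, (min_le_left _ _).trans hc1, C + D, by positivity,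
    fun s hs hs2 => ?_⟩
  have hp : 0 ≤ (1 + |s.im|) ^ (-η) := by positivity
  have h1 : min c d * (1 + |s.im|) ^ (-η) ≤ c * (1 + |s.im|) ^ (-η) := by
    gcongr; exact min_le_left _ _
  have h2 : min c d * (1 + |s.im|) ^ (-η) ≤ d * (1 + |s.im|) ^ (-η) := by
    gcongr; exact min_le_right _ _
  obtain ⟨a1, b1⟩ := h s (by linarith) hs2
  obtain ⟨a2, b2⟩ := k s (by linarith) hs2
  refine ⟨a1.add a2, (norm_add_le _ _).trans ?_⟩
  rw [add_mul]
  exact add_le_add b1 b2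

lemma PolyBounded.const_mul {η : ℝ} {f : ℂ → ℂ} (hf : PolyBounded η f) (z : ℂ) :
    PolyBounded η (fun s => z * f s) := by
  obtain ⟨c, hc, hc1, C, hC, h⟩ := hf
  refine ⟨c, hc, hc1, (‖z‖ + 1) * C, by positivity, fun s hs hs2 => ?_⟩
  obtain ⟨a1, b1⟩ := h s hs hs2
  refine ⟨analyticAt_const.mul a1, ?_⟩
  rw [norm_mul, mul_assoc]
  gcongr
  linarith

lemma polyBounded_zero (η : ℝ) : PolyBounded η (fun _ => 0) := by
  refine ⟨1, one_pos, le_rfl, 1, one_pos, fun s _ _ => ⟨analyticAt_const, ?_⟩⟩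
  rw [norm_zero]
  positivity

lemma PolyBounded.sum {η : ℝ} {ι : Type*} {f : ι → ℂ → ℂ} (t : Finset ι)
    (hf : ∀ i ∈ t, PolyBounded η (f i)) : PolyBounded η (fun s => ∑ i ∈ t, f i s) := by
  classical
  induction t using Finset.induction_on with
  | empty => simpa using polyBounded_zero η
  | insert i t hi ih =>
    simp_rw [Finset.sum_insert hi]
    exact (hf i (by simp)).add (ih fun j hj => hf j (by simp [hj]))

lemma PolyBounded.of_large {ε : ℝ} (hε : 0 < ε) {f : ℂ → ℂ}
    (h1 : ∀ s : ℂ, 1 ≤ s.re → AnalyticAt ℂ f s)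
    (h2 : ∃ c > 0, c ≤ 1 ∧ ∃ C > 0, ∀ s : ℂ, 2 ≤ |s.im| → 1 - c / (|s.im| ^ ε) ^ 8 ≤ s.re →
      s.re ≤ 2 → AnalyticAt ℂ f s ∧ ‖f s‖ ≤ C * (|s.im| ^ ε) ^ 8) :
    PolyBounded (8 * ε) f := by
  obtain ⟨c, hc, hc1, C, hC, h⟩ := h2
  have hK : IsCompact (Set.Icc (1 : ℝ) 2 ×ℂ Set.Icc (-2 : ℝ) 2) :=
    isCompact_Icc.reProdIm isCompact_Icc
  obtain ⟨δ, hδ, hsub⟩ := hK.exists_cthickening_subset_open (isOpen_analyticAt ℂ f)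
    (fun s hs => h1 s hs.1.1)
  obtain ⟨M, hM⟩ := hK.cthickening (r := δ) |>.exists_bound_of_continuousOn
    (f := f) (fun s hs => (hsub hs).continuousAt.continuousWithinAt)
  refine ⟨min c δ, lt_min hc hδ, (min_le_left _ _).trans hc1, C + |M|, by positivity,
    fun s hs hs2 => ?_⟩
  rcases le_total 2 |s.im| with ht | ht
  · have hE : (|s.im| ^ ε) ^ 8 = |s.im| ^ (8 * ε) := by
      rw [← Real.rpow_natCast, ← Real.rpow_mul (abs_nonneg _), mul_comm]; norm_num
    have hle : |s.im| ^ (8 * ε) ≤ (1 + |s.im|) ^ (8 * ε) := by gcongr; linarith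
    have hT : 0 < |s.im| := by linarith
    obtain ⟨a1, b1⟩ := h s ht (by
      have : min c δ * (1 + |s.im|) ^ (-(8 * ε)) ≤ c / (|s.im| ^ ε) ^ 8 := by
        rw [hE, Real.rpow_neg (by positivity), ← div_eq_mul_inv]
        gcongr
        exact min_le_left _ _
      linarith) hs2
    refine ⟨a1, b1.trans ?_⟩
    rw [hE]
    gcongr
    linarith [abs_nonneg M]
  · have hmem : s ∈ Metric.cthickening δ (Set.Icc (1 : ℝ) 2 ×ℂ Set.Icc (-2 : ℝ) 2) := by
      refine Metric.mem_cthickening_of_dist_le s ((max s.re 1 : ℝ) + s.im * I) _ _ ?_ ?_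
      · rw [mem_reProdIm]
        simp [hs2, abs_le.1 ht]
      · rw [dist_eq_norm]
        have : s - ((max s.re 1 : ℝ) + s.im * I) = ((s.re - max s.re 1 : ℝ) : ℂ) := by
          apply Complex.ext <;> simp
        rw [this, norm_real, Real.norm_eq_abs, abs_le]
        have hle : (1 + |s.im|) ^ (-(8 * ε)) ≤ 1 :=
          Real.rpow_le_one_of_one_le_of_nonpos (by linarith [abs_nonneg s.im]) (by linarith)
        have : min c δ * (1 + |s.im|) ^ (-(8 * ε)) ≤ δ * 1 := by
          gcongr
          exact min_le_right _ _
        rcases max_cases s.re 1 with ⟨e, _⟩ | ⟨e, _⟩ <;> rw [e] <;> constructor <;> linarith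
    refine ⟨hsub hmem, (hM s hmem).trans ?_⟩
    have h1 : 1 ≤ (1 + |s.im|) ^ (8 * ε) :=
      Real.one_le_rpow (by linarith [abs_nonneg s.im]) (by positivity)
    nlinarith [le_abs_self M, abs_nonneg M]

lemma ne_one_of_two_le_abs_im {s : ℂ} (h : 2 ≤ |s.im|) : s ≠ 1 := by
  rintro rfl
  simp at h
  linarith

lemma analyticAt_LFunction {N : ℕ} [NeZero N] (χ : DirichletCharacter ℂ N) {s : ℂ} (hs : s ≠ 1) :
    AnalyticAt ℂ χ.LFunction s :=
  DifferentiableOn.analyticAt (s := {1}ᶜ)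
    (fun z hz => (χ.differentiableAt_LFunction z (Or.inl hz)).differentiableWithinAt)
    (isOpen_compl_singleton.mem_nhds hs)

lemma polyBounded_logDeriv_LFunction {N : ℕ} [NeZero N] {χ : DirichletCharacter ℂ N} (hχ : χ ≠ 1)
    {ε : ℝ} (hε : 0 < ε) (hε1 : ε ≤ 1) :
    PolyBounded (8 * ε) (fun s => deriv χ.LFunction s / χ.LFunction s) := by
  refine PolyBounded.of_large hε (fun s hs => ?_) ?_
  · have := (DirichletCharacter.differentiable_LFunction hχ).analyticAt s
    exact this.deriv.div this (χ.LFunction_ne_zero_of_one_le_re (Or.inl hχ) hs)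
  · obtain ⟨c, hc, hc1, C, hC, h⟩ := norm_logDeriv_LFunction_le χ hε hε1
    refine ⟨c, hc, hc1, C, hC, fun s ht hs hs2 => ?_⟩
    obtain ⟨h0, hb⟩ := h s ht hs hs2
    have := analyticAt_LFunction χ (ne_one_of_two_le_abs_im ht)
    exact ⟨this.deriv.div this h0, hb⟩

lemma norm_inv_sub_one_le {s : ℂ} (h : 2 ≤ |s.im|) : ‖(s - 1)⁻¹‖ ≤ 1 := by
  have h1 : |s.im| ≤ ‖s - 1‖ := by simpa using abs_im_le_norm (s - 1)
  rw [norm_inv]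
  exact inv_le_one_of_one_le₀ (by linarith)

open DirichletCharacter in
lemma polyBounded_logDeriv_LFunctionTrivChar₁ (N : ℕ) [NeZero N] {ε : ℝ} (hε : 0 < ε)
    (hε1 : ε ≤ 1) :
    PolyBounded (8 * ε) (fun s => deriv (LFunctionTrivChar₁ N) s / LFunctionTrivChar₁ N s) := by
  have han (s : ℂ) := (differentiable_LFunctionTrivChar₁ N).analyticAt s
  refine PolyBounded.of_large hε (fun s hs => (han s).deriv.div (han s) ?_) ?_
  · rcases eq_or_ne s 1 with rfl | h1
    · exact LFunctionTrivChar₁_apply_one_ne_zero N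
    · rw [LFunctionTrivChar₁, Function.update_of_ne h1]
      exact mul_ne_zero (sub_ne_zero.2 h1)
        (LFunction_ne_zero_of_one_le_re _ (Or.inr h1) hs)
  · obtain ⟨c, hc, hc1, C, hC, h⟩ :=
      norm_logDeriv_LFunction_le (1 : DirichletCharacter ℂ N) hε hε1
    refine ⟨c, hc, hc1, C + 1, by positivity, fun s ht hs hs2 => ?_⟩
    obtain ⟨h0, hb⟩ := h s ht hs hs2
    have h1 := ne_one_of_two_le_abs_im ht
    have h2 : LFunctionTrivChar₁ N s = (s - 1) * LFunctionTrivChar N s := by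
      rw [LFunctionTrivChar₁, Function.update_of_ne h1]
    have h3 : LFunctionTrivChar₁ N s ≠ 0 := by
      rw [h2]; exact mul_ne_zero (sub_ne_zero.2 h1) h0
    refine ⟨(han s).deriv.div (han s) h3, ?_⟩
    have h4 : deriv (LFunctionTrivChar₁ N) s / LFunctionTrivChar₁ N s
        = deriv (LFunction (1 : DirichletCharacter ℂ N)) s / LFunction (1 : DirichletCharacter ℂ N) s
          + (s - 1)⁻¹ := by
      have h5 := sub_ne_zero.2 h1
      rw [deriv_LFunctionTrivChar₁_apply_of_ne_one N h1, h2, LFunctionTrivChar]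
      field_simp
    have hE1 : 1 ≤ (|s.im| ^ ε) ^ 8 := one_le_pow₀ (Real.one_le_rpow (by linarith) hε.le)
    rw [h4]
    refine (norm_add_le _ _).trans ?_
    linarith [norm_inv_sub_one_le ht]

open DirichletCharacter in
lemma polyBounded_dslope {ε : ℝ} (hε : 0 < ε) (hε1 : ε ≤ 1) :
    PolyBounded (8 * ε) (dslope (LFunctionTrivChar₁ 1) 1) := by
  have hd : Differentiable ℂ (dslope (LFunctionTrivChar₁ 1) 1) := by
    rw [← differentiableOn_univ, Complex.differentiableOn_dslope Filter.univ_mem]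
    exact (differentiable_LFunctionTrivChar₁ 1).differentiableOn
  refine PolyBounded.of_large hε (fun s _ => hd.analyticAt s) ?_
  obtain ⟨A, hA, h⟩ := norm_LFunction_deriv_le (1 : DirichletCharacter ℂ 1) hε hε1
  refine ⟨ε / 4, by positivity, by linarith, A + 1, by positivity, fun s ht hs hs2 => ?_⟩
  refine ⟨hd.analyticAt s, ?_⟩
  have h1 := ne_one_of_two_le_abs_im ht
  have hE1 : 1 ≤ |s.im| ^ ε := Real.one_le_rpow (by linarith) hε.le
  have hE8 : 1 ≤ (|s.im| ^ ε) ^ 8 := one_le_pow₀ hE1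
  have hb := (h s (by
    have : ε / 4 / (|s.im| ^ ε) ^ 8 ≤ ε / 4 := div_le_self (by positivity) hE8
    linarith) hs2 ht).1
  have h4 : dslope (LFunctionTrivChar₁ 1) 1 s = LFunction (1 : DirichletCharacter ℂ 1) s
      - (s - 1)⁻¹ := by
    rw [dslope_of_ne _ h1, slope_def_field, LFunctionTrivChar₁, Function.update_of_ne h1,
      Function.update_self, LFunctionTrivChar]
    have h5 := sub_ne_zero.2 h1
    field_simp
    simp
  rw [h4]
  refine (norm_sub_le _ _).trans ?_
  have : |s.im| ^ ε ≤ (|s.im| ^ ε) ^ 8 := le_self_pow₀ hE1 (by norm_num)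
  nlinarith [norm_inv_sub_one_le ht]

open ArithmeticFunction.vonMangoldt

/-- The von Mangoldt function on a residue class, minus its mean value. -/
noncomputable def resCoeff {q : ℕ} (a : ZMod q) (n : ℕ) : ℂ :=
  (residueClass a n : ℂ) - (q.totient : ℂ)⁻¹

lemma lseriesSummable_residueClass {q : ℕ} (a : ZMod q) {s : ℂ} (hs : 1 < s.re) :
    LSeriesSummable (fun n => (residueClass a n : ℂ)) s :=
  LSeriesSummable_of_abscissaOfAbsConv_lt_re <|
    (abscissaOfAbsConv_residueClass_le_one a).trans_lt (by exact_mod_cast hs)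

lemma lseriesSummable_const (z : ℂ) {s : ℂ} (hs : 1 < s.re) :
    LSeriesSummable (fun _ => z) s := by
  have := (LSeriesSummable_one_iff.2 hs).smul z
  simpa [Pi.smul_def] using this

lemma lseriesSummable_resCoeff {q : ℕ} (a : ZMod q) {s : ℂ} (hs : 1 < s.re) :
    LSeriesSummable (resCoeff a) s :=
  (lseriesSummable_residueClass a hs).sub (lseriesSummable_const _ hs)

open DirichletCharacter in
lemma exists_polyBounded_eq_LSeries {q : ℕ} [NeZero q] {a : ZMod q} (ha : IsUnit a) {ε : ℝ}
    (hε : 0 < ε) (hε1 : ε ≤ 1) :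
    ∃ F, PolyBounded (8 * ε) F ∧ ∀ s : ℂ, 1 < s.re → F s = LSeries (resCoeff a) s := by
  classical
  refine ⟨fun s => LFunctionResidueClassAux a s + -(q.totient : ℂ)⁻¹ *
    dslope (LFunctionTrivChar₁ 1) 1 s, ?_, fun s hs => ?_⟩
  · refine PolyBounded.add ?_ ((polyBounded_dslope hε hε1).const_mul _)
    have h1 := (polyBounded_logDeriv_LFunctionTrivChar₁ q hε hε1).const_mul (-1)
    have h2 := PolyBounded.sum (η := 8 * ε) ({1}ᶜ : Finset (DirichletCharacter ℂ q))
      (f := fun χ s => -χ a⁻¹ * (deriv (LFunction χ) s / LFunction χ s))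
      (fun χ hχ => (polyBounded_logDeriv_LFunction (by simpa using hχ) hε hε1).const_mul _)
    have h3 := (h1.add h2).const_mul (q.totient : ℂ)⁻¹
    convert! h3 using 2 with s
    rw [LFunctionResidueClassAux, sub_eq_add_neg, ← Finset.sum_neg_distrib]
    congr 2
    · ring
    · exact Finset.sum_congr (by congr!) fun χ _ => by ring
  · have hs1 : s ≠ 1 := by rintro rfl; simp at hs
    have h1 := eqOn_LFunctionResidueClassAux ha hs
    have h2 : LSeries (resCoeff a) s
        = LSeries (fun n => (residueClass a n : ℂ)) s - (q.totient : ℂ)⁻¹ * riemannZeta s := by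
      have := LSeries_sub (lseriesSummable_residueClass a hs)
        (lseriesSummable_const (q.totient : ℂ)⁻¹ hs)
      rw [show resCoeff a = (fun n => (residueClass a n : ℂ)) - (fun _ => (q.totient : ℂ)⁻¹) from rfl,
        this, ← LSeries_one_eq_riemannZeta hs, ← LSeries_smul]
      congr 2
      ext
      simp
    simp only at h1
    beta_reduce
    rw [h1, h2, dslope_of_ne _ hs1, slope_def_field, LFunctionTrivChar₁, Function.update_of_ne hs1,
      Function.update_self, LFunctionTrivChar, LFunction_modOne_eq]
    have h5 := sub_ne_zero.2 hs1
    simp only [Nat.primeFactors_one, Finset.prod_empty]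
    field_simp
    ring

lemma PolyBounded.norm_iteratedDeriv_le {F : ℂ → ℂ} {η : ℝ} (hη : 0 < η) (hη1 : η ≤ 1 / 6)
    (hF : PolyBounded η F) :
    ∃ C > 0, ∀ s : ℂ, 1 ≤ s.re → s.re ≤ 3 / 2 → AnalyticAt ℂ (fun s => F s / (s * (s + 1))) s ∧
      ∀ n ≤ 2, ‖iteratedDeriv n (fun s => F s / (s * (s + 1))) s‖
        ≤ C * (1 + |s.im|) ^ (-(3 / 2) : ℝ) := by
  obtain ⟨c, hc, hc1, C, hC, h⟩ := hF
  refine ⟨32 * C * (8 / c ^ 2), by positivity, fun s hs hs2 => ?_⟩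
  obtain ⟨T, hT⟩ : ∃ T, T = 1 + |s.im| := ⟨_, rfl⟩
  have hT1 : 1 ≤ T := by rw [hT]; linarith [abs_nonneg s.im]
  have hT0 : 0 < T := by linarith
  obtain ⟨r, hr⟩ : ∃ r, r = c / 2 * T ^ (-η) := ⟨_, rfl⟩
  have hr0 : 0 < r := by rw [hr]; positivity
  have hTη : T ^ (-η) ≤ 1 := Real.rpow_le_one_of_one_le_of_nonpos hT1 (by linarith)
  have hr1 : r ≤ 1 / 2 := by
    rw [hr]
    calc c / 2 * T ^ (-η) ≤ 1 / 2 * 1 := by gcongr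
      _ = 1 / 2 := by norm_num
  have key (w : ℂ) (hw : ‖w - s‖ ≤ r) : AnalyticAt ℂ (fun s => F s / (s * (s + 1))) w ∧
      ‖F w / (w * (w + 1))‖ ≤ 32 * C * T ^ (η - 2) := by
    have him := (abs_im_le_norm _).trans hw
    have hre := (abs_re_le_norm _).trans hw
    rw [sub_re, abs_le] at hre
    rw [sub_im] at him
    have h4 := abs_sub_abs_le_abs_sub s.im w.im
    have h5 := abs_sub_abs_le_abs_sub w.im s.im
    rw [abs_sub_comm] at h4
    have hV : 1 + |w.im| ≤ 2 * T := by rw [hT]; linarith [abs_nonneg s.im]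
    obtain ⟨a1, b1⟩ := h w (by
      have : c * (1 + |w.im|) ^ (-η) ≥ r := by
        rw [hr]
        calc c / 2 * T ^ (-η) = c * (2 ^ (-1 : ℝ) * T ^ (-η)) := by
              rw [Real.rpow_neg_one]; ring
          _ ≤ c * (2 ^ (-η) * T ^ (-η)) := by
              gcongr
              · norm_num
              · linarith
          _ = c * (2 * T) ^ (-η) := by rw [Real.mul_rpow (by norm_num) hT0.le]
          _ ≤ c * (1 + |w.im|) ^ (-η) := by
              gcongr c * ?_
              exact Real.rpow_le_rpow_of_nonpos (by positivity) hV (by linarith)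
      linarith) (by linarith)
    have hwre : 1 / 2 ≤ ‖w‖ := le_trans (by linarith) (re_le_norm w)
    have hw1 : ‖w‖ ≤ ‖w + 1‖ := by
      rw [Complex.norm_def, Complex.norm_def]
      apply Real.sqrt_le_sqrt
      simp only [normSq_apply, add_re, one_re, add_im, one_im, add_zero]
      nlinarith
    have hwT : T ≤ 4 * ‖w‖ := by rw [hT]; linarith [abs_im_le_norm w]
    have hne : w * (w + 1) ≠ 0 := by
      rw [← norm_pos_iff, norm_mul]
      nlinarith
    refine ⟨a1.div (analyticAt_id.mul (analyticAt_id.add analyticAt_const)) hne, ?_⟩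
    rw [norm_div, norm_mul, div_le_iff₀ (by nlinarith)]
    have e1 : (1 + |w.im|) ^ η ≤ 2 * T ^ η := by
      calc (1 + |w.im|) ^ η ≤ (2 * T) ^ η := by gcongr
        _ = 2 ^ η * T ^ η := Real.mul_rpow (by norm_num) hT0.le
        _ ≤ 2 ^ (1 : ℝ) * T ^ η := by
            gcongr
            · norm_num
            · linarith
        _ = 2 * T ^ η := by rw [Real.rpow_one]
    have e2 : T ^ (η - 2) * T ^ 2 = T ^ η := by
      rw [← Real.rpow_natCast, ← Real.rpow_add hT0]; norm_num
    have e3 : T ^ 2 ≤ 16 * (‖w‖ * ‖w + 1‖) := by nlinarith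
    calc ‖F w‖ ≤ C * (2 * T ^ η) := b1.trans (by gcongr)
      _ = 2 * C * T ^ (η - 2) * T ^ 2 := by rw [← e2]; ring
      _ ≤ 2 * C * T ^ (η - 2) * (16 * (‖w‖ * ‖w + 1‖)) := by gcongr
      _ = _ := by ring
  refine ⟨(key s (by simpa using hr0.le)).1, fun n hn => ?_⟩
  have hcauchy := Complex.norm_iteratedDeriv_le_of_forall_mem_sphere_norm_le n hr0
    (f := fun s => F s / (s * (s + 1))) (c := s) (C := 32 * C * T ^ (η - 2)) ?_ ?_
  · refine hcauchy.trans ?_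
    rw [← hT]
    have hfac : (n.factorial : ℝ) ≤ 2 := by exact_mod_cast Nat.factorial_le hn
    have hrn : r ^ 2 ≤ r ^ n := pow_le_pow_of_le_one hr0.le (by linarith) hn
    have hr2 : r ^ 2 = c ^ 2 / 4 * T ^ (-2 * η) := by
      rw [hr, mul_pow, ← Real.rpow_natCast (T ^ (-η)), ← Real.rpow_mul hT0.le]
      norm_num
      ring_nf
    have e4 : T ^ (η - 2) ≤ T ^ (-(3 / 2) : ℝ) * T ^ (-2 * η) := by
      rw [← Real.rpow_add hT0]
      exact Real.rpow_le_rpow_of_exponent_le hT1 (by linarith)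
    calc (n.factorial : ℝ) * (32 * C * T ^ (η - 2)) / r ^ n
        ≤ 2 * (32 * C * (T ^ (-(3 / 2) : ℝ) * T ^ (-2 * η))) / r ^ 2 := by gcongr
      _ = _ := by
        rw [hr2]
        have : T ^ (-2 * η) ≠ 0 := by positivity
        field_simp
        norm_num
  · apply DifferentiableOn.diffContOnCl
    intro z hz
    rw [closure_ball _ hr0.ne', Metric.mem_closedBall, dist_eq_norm] at hz
    exact (key z hz).1.differentiableAt.differentiableWithinAt
  · intro z hz
    rw [mem_sphere_iff_norm] at hz
    exact (key z hz.le).2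

theorem exists_kernel_bound {q : ℕ} [NeZero q] {a : ZMod q} (ha : IsUnit a) :
    ∃ K : ℂ → ℂ, (∀ s : ℂ, 1 < s.re → K s = LSeries (resCoeff a) s / (s * (s + 1))) ∧
      ∃ C > 0, ∀ s : ℂ, 1 ≤ s.re → s.re ≤ 3 / 2 → AnalyticAt ℂ K s ∧
        ∀ n ≤ 2, ‖iteratedDeriv n K s‖ ≤ C * (1 + |s.im|) ^ (-(3 / 2) : ℝ) := by
  obtain ⟨F, hF, h⟩ := exists_polyBounded_eq_LSeries ha (ε := 1 / 48) (by norm_num) (by norm_num)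
  exact ⟨fun s => F s / (s * (s + 1)), fun s hs => by beta_reduce; rw [h s hs],
    hF.norm_iteratedDeriv_le (by norm_num) (by norm_num)⟩

open MeasureTheory

lemma norm_inv_mul_add_one_le {s : ℂ} (hs : 1 ≤ s.re) :
    s * (s + 1) ≠ 0 ∧ ‖(s * (s + 1))⁻¹‖ ≤ 4 * (1 + |s.im|) ^ (-2 : ℝ) := by
  have h1 : 1 ≤ ‖s‖ := hs.trans (re_le_norm s)
  have h2 : 1 ≤ ‖s + 1‖ := le_trans (by simp; linarith) (re_le_norm (s + 1))
  have h3 := abs_im_le_norm s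
  have h4 : |s.im| ≤ ‖s + 1‖ := by simpa using abs_im_le_norm (s + 1)
  have h0 := abs_nonneg s.im
  constructor
  · rw [← norm_pos_iff, norm_mul]; nlinarith
  · rw [norm_inv, norm_mul, Real.rpow_neg (by linarith), ← div_eq_mul_inv, inv_eq_one_div,
      div_le_div_iff₀ (by nlinarith) (by positivity)]
    norm_num
    nlinarith

lemma integrable_one_add_abs_rpow {r : ℝ} (hr : 1 < r) :
    Integrable (fun y : ℝ => (1 + |y|) ^ (-r)) := by
  have := integrable_one_add_norm (E := ℝ) (μ := volume) (r := r) (by simpa using hr)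
  simpa using this

lemma integrable_mul_inv {σ : ℝ} (hσ : 1 ≤ σ) {g : ℝ → ℂ} (hg : Continuous g) {B : ℝ}
    (hB : ∀ y, ‖g y‖ ≤ B) :
    Integrable (fun y : ℝ => g y * (((σ + y * I : ℂ) * (σ + y * I + 1))⁻¹)) := by
  have hne (y : ℝ) := norm_inv_mul_add_one_le (s := σ + y * I) (by simpa using hσ)
  refine ((integrable_one_add_abs_rpow (one_lt_two)).const_mul (B * 4)).mono' ?_ ?_
  · refine (hg.mul (Continuous.inv₀ (by fun_prop) fun y => (hne y).1)).aestronglyMeasurable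
  · refine Eventually.of_forall fun y => ?_
    have := (hne y).2
    simp only [add_im, ofReal_im, mul_im, ofReal_re, I_im, mul_one, I_re, mul_zero, add_zero,
      zero_add] at this
    rw [norm_mul, mul_assoc]
    exact mul_le_mul (hB y) this (norm_nonneg _) ((norm_nonneg _).trans (hB y))

lemma continuous_cpow_line {u : ℝ} (hu : 0 < u) (σ : ℝ) :
    Continuous fun y : ℝ => (u : ℂ) ^ (σ + y * I : ℂ) :=
  Continuous.const_cpow (by fun_prop) (Or.inl (by exact_mod_cast hu.ne'))

lemma norm_cpow_line {u : ℝ} (hu : 0 < u) (σ y : ℝ) :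
    ‖(u : ℂ) ^ (σ + y * I : ℂ)‖ = u ^ σ := by
  rw [norm_cpow_eq_rpow_re_of_pos hu]; simp

lemma integral_cpow_div {σ : ℝ} (hσ : 1 ≤ σ) {u : ℝ} (hu : 0 < u) :
    ∫ y : ℝ, (u : ℂ) ^ (-(σ + y * I) : ℂ) * (((σ + y * I : ℂ) * (σ + y * I + 1))⁻¹)
      = 2 * Real.pi * (max (1 - u) 0 : ℝ) := by
  set f : ℝ → ℂ := fun t => Set.indicator (Set.Ioc 0 1) (fun _ => 1 : ℝ → ℂ) t
    - Set.indicator (Set.Ioc 0 1) (fun t => (t : ℂ) ^ (1 : ℂ) : ℝ → ℂ) t with hf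
  have hm (s : ℂ) (hs : 1 ≤ s.re) : HasMellin f s ((s * (s + 1))⁻¹) := by
    have h1 := hasMellin_one_Ioc (s := s) (by linarith)
    have h2 := hasMellin_cpow_Ioc 1 (s := s) (by simp; linarith)
    have := hasMellin_sub h1.1 h2.1
    rw [h1.2, h2.2] at this
    convert! this using 1
    have h3 := norm_inv_mul_add_one_le hs
    have h4 := left_ne_zero_of_mul h3.1
    have h5 := right_ne_zero_of_mul h3.1
    field_simp
    ring
  have hfv (t : ℝ) (ht : 0 < t) : f t = (max (1 - t) 0 : ℝ) := by
    rcases le_or_gt t 1 with h | h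
    · rw [hf]
      simp only [Set.indicator_of_mem (show t ∈ Set.Ioc (0 : ℝ) 1 from ⟨ht, h⟩), cpow_one]
      rw [max_eq_left (by linarith)]
      simp
    · rw [hf]
      simp only [Set.indicator_of_notMem (show t ∉ Set.Ioc (0 : ℝ) 1 from fun h' => by linarith [h'.2])]
      rw [max_eq_right (by linarith)]
      simp
  have hc : ContinuousAt f u := by
    have h1 : Continuous fun t : ℝ => ((max (1 - t) 0 : ℝ) : ℂ) := by fun_prop
    refine h1.continuousAt.congr ?_
    filter_upwards [lt_mem_nhds hu] with t ht using (hfv t ht).symm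
  have hml (y : ℝ) : mellin f (σ + y * I) = ((σ + y * I : ℂ) * (σ + y * I + 1))⁻¹ :=
    (hm _ (by simpa using hσ)).2
  have hv : VerticalIntegrable (mellin f) σ := by
    rw [VerticalIntegrable]
    simp_rw [hml]
    simpa using integrable_mul_inv hσ (g := fun _ => 1) continuous_const (B := 1) (by simp)
  have := mellinInv_mellin_eq σ f hu (hm σ (by simpa using hσ)).1 hv hc
  rw [mellinInv, hfv u hu] at this
  simp_rw [hml, smul_eq_mul] at this
  rw [← this, Complex.real_smul]
  have hpi : (Real.pi : ℂ) ≠ 0 := by exact_mod_cast Real.pi_ne_zero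
  generalize ∫ y : ℝ, (u : ℂ) ^ (-(σ + y * I) : ℂ) * (((σ + y * I : ℂ) * (σ + y * I + 1))⁻¹) = J
  push_cast
  field_simp

lemma hasSum_mul_max {b : ℕ → ℂ} {σ : ℝ} (hσ : 1 ≤ σ) (hb : LSeriesSummable b σ) {X : ℝ}
    (hX : 0 < X) :
    HasSum (fun n : ℕ => if n = 0 then 0 else b n * (2 * Real.pi * (max (1 - n / X) 0 : ℝ)))
      (∫ y : ℝ, LSeries b (σ + y * I) * (X : ℂ) ^ (σ + y * I : ℂ)
        * (((σ + y * I : ℂ) * (σ + y * I + 1))⁻¹)) := by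
  have hnorm (n : ℕ) (y : ℝ) : ‖LSeries.term b (σ + y * I) n‖ = ‖LSeries.term b σ n‖ := by
    simp [LSeries.norm_term_eq]
  have hcont (n : ℕ) : Continuous fun y : ℝ => LSeries.term b (σ + y * I) n := by
    rcases eq_or_ne n 0 with rfl | hn
    · simp only [LSeries.term_zero]; exact continuous_const
    · simp only [LSeries.term_of_ne_zero hn]
      have hn' : (0 : ℝ) < n := by exact_mod_cast Nat.pos_of_ne_zero hn
      have h := continuous_cpow_line hn' σ
      have hne (y : ℝ) : ((n : ℝ) : ℂ) ^ (σ + y * I : ℂ) ≠ 0 := by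
        rw [← norm_pos_iff, norm_cpow_line hn']; positivity
      exact_mod_cast continuous_const.div h hne
  have hInt (n : ℕ) := integrable_mul_inv hσ
    (g := fun y => LSeries.term b (σ + y * I) n * (X : ℂ) ^ (σ + y * I : ℂ))
    ((hcont n).mul (continuous_cpow_line hX σ)) (B := ‖LSeries.term b σ n‖ * X ^ σ)
    (fun y => by rw [norm_mul, hnorm, norm_cpow_line hX])
  have hsum : Summable fun n : ℕ => ∫ y : ℝ, ‖LSeries.term b (σ + y * I) n
      * (X : ℂ) ^ (σ + y * I : ℂ) * (((σ + y * I : ℂ) * (σ + y * I + 1))⁻¹)‖ := by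
    simp_rw [norm_mul, hnorm, mul_assoc, integral_const_mul]
    exact hb.norm.mul_right _
  have key := hasSum_integral_of_summable_integral_norm hInt hsum
  convert! key using 1
  · ext n
    rcases eq_or_ne n 0 with rfl | hn
    · simp
    · rw [if_neg hn]
      have hn' : (0 : ℝ) < n := by exact_mod_cast Nat.pos_of_ne_zero hn
      rw [← integral_cpow_div hσ (div_pos hn' hX), ← integral_const_mul]
      congr 1
      ext y
      rw [LSeries.term_of_ne_zero hn, ofReal_div, ofReal_natCast, div_eq_mul_inv (n : ℂ),
        show ((n : ℂ) * (X : ℂ)⁻¹) = ((n : ℝ) : ℂ) * ((X⁻¹ : ℝ) : ℂ) by push_cast; ring,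
        Complex.mul_cpow_ofReal_nonneg hn'.le (by positivity), ofReal_inv,
        Complex.cpow_neg, Complex.inv_cpow _ _ (by rw [arg_ofReal_of_nonneg hX.le]; exact Real.pi_pos.ne),
        Complex.cpow_neg, inv_inv, ofReal_natCast]
      ring
  · congr 1
    ext y
    simp_rw [LSeries]
    rw [tsum_mul_right, tsum_mul_right]

lemma integral_mul_cpow_eq {f f' : ℝ → ℂ} {σ X : ℝ} (hX : 1 < X)
    (hf : ∀ y, HasDerivAt f (I * f' y) y) (hi : Integrable f) (hi' : Integrable f') :
    ∫ y : ℝ, f y * (X : ℂ) ^ (σ + y * I : ℂ)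
      = -(Real.log X : ℂ)⁻¹ * ∫ y : ℝ, f' y * (X : ℂ) ^ (σ + y * I : ℂ) := by
  have hX0 : 0 < X := by linarith
  have hlog : (Real.log X : ℂ) ≠ 0 := by exact_mod_cast (Real.log_pos hX).ne'
  have hv (y : ℝ) : HasDerivAt (fun y : ℝ => (X : ℂ) ^ (σ + y * I : ℂ))
      (I * Real.log X * (X : ℂ) ^ (σ + y * I : ℂ)) y := by
    have h1 : HasDerivAt (fun y : ℝ => (σ + y * I : ℂ)) (1 * I) y :=
      ((HasDerivAt.ofReal_comp (hasDerivAt_id y)).mul_const I).const_add _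
    have h2 := (Complex.hasStrictDerivAt_const_cpow (x := (X : ℂ)) (y := σ + y * I)
      (Or.inl (by exact_mod_cast hX0.ne'))).hasDerivAt
    convert! h2.scomp y h1 using 1
    rw [ofReal_log hX0.le, smul_eq_mul]
    ring
  have hInt {g : ℝ → ℂ} (hg : Integrable g) :
      Integrable (fun y : ℝ => g y * (X : ℂ) ^ (σ + y * I : ℂ)) :=
    hg.mul_bdd (c := X ^ σ) (continuous_cpow_line hX0 σ).aestronglyMeasurable
      (Eventually.of_forall fun y => (norm_cpow_line hX0 σ y).le)
  have h1 : Integrable (f * fun y : ℝ => I * Real.log X * (X : ℂ) ^ (σ + y * I : ℂ)) := by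
    convert! (hInt hi).const_mul (I * Real.log X) using 1
    ext y; simp only [Pi.mul_apply]; ring
  have h2 : Integrable ((fun y => I * f' y) * fun y : ℝ => (X : ℂ) ^ (σ + y * I : ℂ)) := by
    convert! (hInt hi').const_mul I using 1
    ext y; simp only [Pi.mul_apply]; ring
  have key := integral_mul_deriv_eq_deriv_mul_of_integrable (fun y _ => hf y) (fun y _ => hv y)
    h1 h2 (hInt hi)
  have e1 : ∫ y : ℝ, f y * (I * Real.log X * (X : ℂ) ^ (σ + y * I : ℂ))
      = I * Real.log X * ∫ y : ℝ, f y * (X : ℂ) ^ (σ + y * I : ℂ) := by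
    rw [← integral_const_mul]; congr 1; ext y; ring
  have e2 : ∫ y : ℝ, I * f' y * (X : ℂ) ^ (σ + y * I : ℂ)
      = I * ∫ y : ℝ, f' y * (X : ℂ) ^ (σ + y * I : ℂ) := by
    rw [← integral_const_mul]; congr 1; ext y; ring
  rw [e1, e2] at key
  have hI := I_ne_zero
  have : Real.log X * ∫ y : ℝ, f y * (X : ℂ) ^ (σ + y * I : ℂ)
      = - ∫ y : ℝ, f' y * (X : ℂ) ^ (σ + y * I : ℂ) := by
    apply mul_left_cancel₀ hI
    linear_combination key
  generalize ∫ y : ℝ, f y * (X : ℂ) ^ (σ + y * I : ℂ) = J at *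
  generalize ∫ y : ℝ, f' y * (X : ℂ) ^ (σ + y * I : ℂ) = J' at *
  field_simp
  linear_combination this

theorem norm_sum_resCoeff_le {q : ℕ} [NeZero q] {a : ZMod q} (ha : IsUnit a) :
    ∃ C > 0, ∀ X : ℝ, Real.exp 2 ≤ X →
      ‖∑ n ∈ Finset.Icc 1 ⌊X⌋₊, resCoeff a n * ((1 - n / X : ℝ) : ℂ)‖
        ≤ C * (X / Real.log X ^ 2) := by
  obtain ⟨K, hK, C, hC, hb⟩ := exists_kernel_bound ha
  obtain ⟨J, hJ⟩ : ∃ J, J = ∫ y : ℝ, (1 + |y|) ^ (-(3 / 2) : ℝ) := ⟨_, rfl⟩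
  have hJ0 : 0 ≤ J := by rw [hJ]; exact integral_nonneg fun y => by positivity
  refine ⟨C * J * Real.exp 1 + 1, by positivity, fun X hX => ?_⟩
  have hX0 : 0 < X := (Real.exp_pos 2).trans_le hX
  have hX1 : 1 < X := lt_of_lt_of_le (Real.one_lt_exp_iff.2 two_pos) hX
  have hlog2 : 2 ≤ Real.log X := by rwa [Real.le_log_iff_exp_le hX0]
  have hlog0 : 0 < Real.log X := by linarith
  obtain ⟨σ, hσ⟩ : ∃ σ, σ = 1 + 1 / Real.log X := ⟨_, rfl⟩
  have hσ1 : 1 < σ := by rw [hσ]; linarith [one_div_pos.2 hlog0]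
  have hσ2 : σ ≤ 3 / 2 := by
    have : 1 / Real.log X ≤ 1 / 2 := one_div_le_one_div_of_le two_pos hlog2
    rw [hσ]; linarith
  have hXσ : X ^ σ = X * Real.exp 1 := by
    rw [hσ, Real.rpow_add hX0, Real.rpow_one, Real.rpow_def_of_pos hX0,
      mul_one_div_cancel hlog0.ne']
  have hline (y : ℝ) := hb (σ + y * I) (by simpa using hσ1.le) (by simpa using hσ2)
  simp only [add_im, ofReal_im, mul_im, ofReal_re, I_im, mul_one, I_re, mul_zero, add_zero,
    zero_add] at hline
  have hder (n : ℕ) (y : ℝ) : HasDerivAt (fun y : ℝ => iteratedDeriv n K (σ + y * I))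
      (I * iteratedDeriv (n + 1) K (σ + y * I)) y := by
    have h0 : AnalyticAt ℂ (iteratedDeriv n K) (σ + y * I) := by
      rw [iteratedDeriv_eq_iterate]
      exact (hline y).1.iterated_deriv n
    have h1 : HasDerivAt (fun y : ℝ => (σ + y * I : ℂ)) (1 * I) y :=
      ((HasDerivAt.ofReal_comp (hasDerivAt_id y)).mul_const I).const_add _
    have h2 := h0.differentiableAt.hasDerivAt
    rw [← iteratedDeriv_succ] at h2
    have h3 := h2.scomp y h1
    simpa [Function.comp_def] using h3
  have hcont (n : ℕ) : Continuous fun y : ℝ => iteratedDeriv n K (σ + y * I) :=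
    continuous_iff_continuousAt.2 fun y => (hder n y).continuousAt
  have hInt (n : ℕ) (hn : n ≤ 2) : Integrable fun y : ℝ => iteratedDeriv n K (σ + y * I) := by
    refine ((integrable_one_add_abs_rpow (by norm_num : (1 : ℝ) < 3 / 2)).const_mul C).mono'
      (hcont n).aestronglyMeasurable (Eventually.of_forall fun y => (hline y).2 n hn)
  have h1 := integral_mul_cpow_eq (σ := σ) hX1 (hder 0) (hInt 0 (by norm_num)) (hInt 1 (by norm_num))
  have h2 := integral_mul_cpow_eq (σ := σ) hX1 (hder 1) (hInt 1 (by norm_num)) (hInt 2 le_rfl)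
  simp only [Nat.zero_add, Nat.reduceAdd] at h1 h2
  have hsum := hasSum_mul_max hσ1.le (lseriesSummable_resCoeff a (by simpa using hσ1)) hX0
  have hfin : ∑ n ∈ Finset.Icc 1 ⌊X⌋₊, resCoeff a n * (2 * Real.pi * ((1 - n / X : ℝ) : ℂ))
      = ∫ y : ℝ, iteratedDeriv 0 K (σ + y * I) * (X : ℂ) ^ (σ + y * I : ℂ) := by
    have h3 : ∀ n ∉ Finset.Icc 1 ⌊X⌋₊, (fun n : ℕ => if n = 0 then 0 else
        resCoeff a n * (2 * Real.pi * (max (1 - n / X) 0 : ℝ))) n = 0 := by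
      intro n hn
      rcases eq_or_ne n 0 with rfl | h0
      · simp
      · rw [Finset.mem_Icc, not_and, not_le, Nat.floor_lt hX0.le] at hn
        have : X < n := hn (Nat.one_le_iff_ne_zero.2 h0)
        have h4 : 1 ≤ n / X := by rw [one_le_div hX0]; exact this.le
        simp [h0, max_eq_right (by linarith : 1 - n / X ≤ 0)]
    have h5 := (hasSum_sum_of_ne_finset_zero h3).unique hsum
    rw [show (∫ y : ℝ, iteratedDeriv 0 K (σ + y * I) * (X : ℂ) ^ (σ + y * I : ℂ))
      = ∫ y : ℝ, LSeries (resCoeff a) (σ + y * I) * (X : ℂ) ^ (σ + y * I : ℂ)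
        * (((σ + y * I : ℂ) * (σ + y * I + 1))⁻¹) from ?_, ← h5]
    · refine Finset.sum_congr rfl fun n hn => ?_
      rw [Finset.mem_Icc, Nat.le_floor_iff hX0.le] at hn
      have h4 : n / X ≤ 1 := by rw [div_le_one hX0]; exact hn.2
      rw [if_neg (by lia), max_eq_left (by linarith)]
    · congr 1
      ext y
      rw [iteratedDeriv_zero, hK _ (by simpa using hσ1), div_eq_mul_inv]
      ring
  have hbd : ‖∫ y : ℝ, iteratedDeriv 2 K (σ + y * I) * (X : ℂ) ^ (σ + y * I : ℂ)‖
      ≤ C * J * (X * Real.exp 1) := by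
    rw [hJ, ← hXσ, ← integral_const_mul, ← integral_mul_const]
    refine norm_integral_le_of_norm_le
      (((integrable_one_add_abs_rpow (by norm_num : (1 : ℝ) < 3 / 2)).const_mul C).mul_const _)
      (Eventually.of_forall fun y => ?_)
    rw [norm_mul, norm_cpow_line hX0]
    gcongr
    exact (hline y).2 2 le_rfl
  have hS : ∑ n ∈ Finset.Icc 1 ⌊X⌋₊, resCoeff a n * (2 * Real.pi * ((1 - n / X : ℝ) : ℂ))
      = 2 * Real.pi * ∑ n ∈ Finset.Icc 1 ⌊X⌋₊, resCoeff a n * ((1 - n / X : ℝ) : ℂ) := by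
    rw [Finset.mul_sum]
    exact Finset.sum_congr rfl fun n _ => by ring
  rw [hS, h1, h2] at hfin
  have hn := congrArg norm hfin
  simp only [norm_mul, norm_neg, norm_inv, norm_real, Real.norm_eq_abs, abs_of_pos hlog0,
    abs_of_pos Real.pi_pos, norm_ofNat] at hn
  generalize ‖∑ n ∈ Finset.Icc 1 ⌊X⌋₊, resCoeff a n * ((1 - n / X : ℝ) : ℂ)‖ = S at *
  have hSle : 2 * Real.pi * S ≤ C * J * Real.exp 1 * (X / Real.log X ^ 2) := by
    rw [hn, ← mul_assoc]
    calc _ ≤ (Real.log X)⁻¹ * (Real.log X)⁻¹ * (C * J * (X * Real.exp 1)) := by gcongr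
      _ = _ := by field_simp
  have hS0 : 0 ≤ X / Real.log X ^ 2 := by positivity
  have : S ≤ 2 * Real.pi * S ∨ S ≤ 0 := by
    rcases le_total S 0 with h | h
    · exact Or.inr h
    · left; nlinarith [Real.pi_gt_three]
  rcases this with h | h
  · linarith
  · refine h.trans (by positivity)

/-- The Chebyshev function `ψ(x; q, a)`. -/
noncomputable def psiAP {q : ℕ} (a : ZMod q) (x : ℝ) : ℝ :=
  ∑ n ∈ Finset.Icc 1 ⌊x⌋₊, residueClass a n

/-- The integral of `ψ(t; q, a)` over `t ≤ x`. -/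
noncomputable def psiAPInt {q : ℕ} (a : ZMod q) (x : ℝ) : ℝ :=
  ∑ n ∈ Finset.Icc 1 ⌊x⌋₊, residueClass a n * (x - n)

lemma sum_Icc_sub_natCast (x : ℝ) (N : ℕ) :
    ∑ n ∈ Finset.Icc 1 N, (x - n) = N * x - N * (N + 1) / 2 := by
  induction N with
  | zero => simp
  | succ k ih =>
    rw [Finset.sum_Icc_succ_top (by omega), ih]
    push_cast
    ring

lemma abs_psiAPInt_sub_le {q : ℕ} [NeZero q] {a : ZMod q} (ha : IsUnit a) :
    ∃ C > 0, ∀ x : ℝ, Real.exp 2 ≤ x →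
      |psiAPInt a x - (q.totient : ℝ)⁻¹ * x ^ 2 / 2| ≤ C * (x ^ 2 / Real.log x ^ 2) := by
  obtain ⟨C, hC, h⟩ := norm_sum_resCoeff_le ha
  obtain ⟨c, hc⟩ : ∃ c, c = (q.totient : ℝ)⁻¹ := ⟨_, rfl⟩
  have hc0 : 0 ≤ c := by rw [hc]; positivity
  refine ⟨C + 4 * c, by positivity, fun x hx => ?_⟩
  have hx1 : 1 < x := lt_of_lt_of_le (by simp) hx
  have hx0 : 0 < x := by linarith
  have hlog : 2 ≤ Real.log x := by rwa [Real.le_log_iff_exp_le hx0]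
  have key : ∑ n ∈ Finset.Icc 1 ⌊x⌋₊, resCoeff a n * ((1 - n / x : ℝ) : ℂ)
      = (((psiAPInt a x - c * (⌊x⌋₊ * x - ⌊x⌋₊ * (⌊x⌋₊ + 1) / 2)) / x : ℝ) : ℂ) := by
    rw [← sum_Icc_sub_natCast, psiAPInt, Finset.mul_sum, ← Finset.sum_sub_distrib,
      Finset.sum_div, ofReal_sum]
    refine Finset.sum_congr rfl fun n _ => ?_
    have : resCoeff a n = ((residueClass a n - c : ℝ) : ℂ) := by
      rw [resCoeff, hc]; push_cast; rfl
    rw [this, ← ofReal_mul]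
    congr 1
    field_simp
  have h1 := h x hx
  rw [key, norm_real, Real.norm_eq_abs, abs_div, abs_of_pos hx0, div_le_iff₀ hx0] at h1
  have hN1 : (⌊x⌋₊ : ℝ) ≤ x := Nat.floor_le hx0.le
  have hN2 : x < ⌊x⌋₊ + 1 := Nat.lt_floor_add_one x
  have h2 : |c * (⌊x⌋₊ * x - ⌊x⌋₊ * (⌊x⌋₊ + 1) / 2) - c * x ^ 2 / 2| ≤ c * x := by
    rw [mul_div_assoc c (x ^ 2), ← mul_sub, abs_mul, abs_of_nonneg hc0]
    gcongr
    rw [abs_le]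
    constructor <;> nlinarith
  have hlx : x ≤ 4 * (x ^ 2 / Real.log x ^ 2) := by
    have hs : Real.log x ≤ 2 * √x := by
      have := Real.log_le_sub_one_of_pos (Real.sqrt_pos.2 hx0)
      rw [Real.log_sqrt hx0.le] at this
      linarith
    have hs2 : Real.log x ^ 2 ≤ 4 * x := by
      calc _ ≤ (2 * √x) ^ 2 := by gcongr
        _ = _ := by rw [mul_pow, Real.sq_sqrt hx0.le]; norm_num
    rw [mul_div_assoc', le_div_iff₀ (by positivity)]
    nlinarith
  rw [← hc]
  calc _ ≤ |psiAPInt a x - c * (⌊x⌋₊ * x - ⌊x⌋₊ * (⌊x⌋₊ + 1) / 2)|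
        + |c * (⌊x⌋₊ * x - ⌊x⌋₊ * (⌊x⌋₊ + 1) / 2) - c * x ^ 2 / 2| := abs_sub_le _ _ _
    _ ≤ C * (x / Real.log x ^ 2) * x + c * (4 * (x ^ 2 / Real.log x ^ 2)) := by
        gcongr
        exact h2.trans (by gcongr)
    _ = _ := by ring

lemma sub_mul_psiAP_le {q : ℕ} (a : ZMod q) {x y : ℝ} (hx : 0 ≤ x) (hy : 0 ≤ y) :
    (y - x) * psiAP a x ≤ psiAPInt a y - psiAPInt a x := by
  have hT : ∀ z : ℝ, 0 ≤ z → z ≤ max x y → psiAPInt a z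
      = ∑ n ∈ Finset.Icc 1 ⌊max x y⌋₊, if (n : ℝ) ≤ z then residueClass a n * (z - n) else 0 := by
    intro z hz hzm
    rw [psiAPInt, ← Finset.sum_filter]
    refine Finset.sum_congr ?_ fun _ _ => rfl
    ext n
    simp only [Finset.mem_Icc, Finset.mem_filter]
    rw [Nat.le_floor_iff hz, Nat.le_floor_iff (hz.trans hzm)]
    exact ⟨fun h => ⟨⟨h.1, h.2.trans hzm⟩, h.2⟩, fun h => ⟨h.1.1, h.2⟩⟩
  have hP : psiAP a x
      = ∑ n ∈ Finset.Icc 1 ⌊max x y⌋₊, if (n : ℝ) ≤ x then residueClass a n else 0 := by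
    rw [psiAP, ← Finset.sum_filter]
    refine Finset.sum_congr ?_ fun _ _ => rfl
    ext n
    simp only [Finset.mem_Icc, Finset.mem_filter]
    rw [Nat.le_floor_iff hx, Nat.le_floor_iff (hx.trans (le_max_left _ _))]
    exact ⟨fun h => ⟨⟨h.1, h.2.trans (le_max_left _ _)⟩, h.2⟩, fun h => ⟨h.1.1, h.2⟩⟩
  rw [hT x hx (le_max_left _ _), hT y hy (le_max_right _ _), hP, Finset.mul_sum,
    ← Finset.sum_sub_distrib]
  refine Finset.sum_le_sum fun n _ => ?_
  have := residueClass_nonneg a n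
  split_ifs with h1 h2 h2 <;> nlinarith

theorem abs_psiAP_sub_le {q : ℕ} [NeZero q] {a : ZMod q} (ha : IsUnit a) :
    ∃ C > 0, ∀ x : ℝ, Real.exp 4 ≤ x →
      |psiAP a x - (q.totient : ℝ)⁻¹ * x| ≤ C * (x / Real.log x) := by
  obtain ⟨C, hC, h⟩ := abs_psiAPInt_sub_le ha
  obtain ⟨c, hc⟩ : ∃ c, c = (q.totient : ℝ)⁻¹ := ⟨_, rfl⟩
  have hc0 : 0 ≤ c := by rw [hc]; positivity
  rw [← hc] at h ⊢
  refine ⟨5 * C + c, by positivity, fun x hx => ?_⟩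
  have hx0 : 0 < x := lt_of_lt_of_le (Real.exp_pos 4) hx
  have hlog : 4 ≤ Real.log x := by rwa [Real.le_log_iff_exp_le hx0]
  obtain ⟨L, hL⟩ : ∃ L, L = Real.log x := ⟨_, rfl⟩
  rw [← hL] at hlog ⊢
  obtain ⟨k, hk⟩ : ∃ k, k = x / L := ⟨_, rfl⟩
  have hk0 : 0 < k := by rw [hk]; positivity
  have hkL : x = k * L := by rw [hk]; field_simp
  have hk4 : 4 * k ≤ x := by nlinarith
  have hs : Real.exp 2 ≤ √x := by
    apply Real.le_sqrt_of_sq_le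
    rw [← Real.exp_nat_mul]
    norm_num
    exact hx
  have he2 : 2 ≤ Real.exp 2 := by linarith [Real.add_one_le_exp 2]
  have hs2 : √x ≤ x - k := by nlinarith [Real.sq_sqrt hx0.le]
  have hee : Real.exp 2 ≤ x := hs.trans (by linarith)
  have hlm : L / 2 ≤ Real.log (x - k) := by
    rw [hL, ← Real.log_sqrt hx0.le]
    exact Real.log_le_log (by positivity) hs2
  have hlp : L ≤ Real.log (x + k) := by
    rw [hL]; exact Real.log_le_log hx0 (by linarith)
  have e0 := h x hee
  rw [← hL] at e0
  have ep : |psiAPInt a (x + k) - c * (x + k) ^ 2 / 2| ≤ C * (4 * k ^ 2) := by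
    refine (h (x + k) (by linarith)).trans ?_
    gcongr
    rw [div_le_iff₀ (by nlinarith)]
    calc (x + k) ^ 2 ≤ (2 * x) ^ 2 := by gcongr; linarith
      _ = 4 * k ^ 2 * L ^ 2 := by rw [hkL]; ring
      _ ≤ _ := by gcongr
  have em : |psiAPInt a (x - k) - c * (x - k) ^ 2 / 2| ≤ C * (4 * k ^ 2) := by
    refine (h (x - k) (hs.trans hs2)).trans ?_
    gcongr
    rw [div_le_iff₀ (by nlinarith)]
    calc (x - k) ^ 2 ≤ x ^ 2 := by gcongr <;> linarith
      _ = 4 * k ^ 2 * (L / 2) ^ 2 := by rw [hkL]; ring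
      _ ≤ _ := by gcongr
  have e0' : x ^ 2 / L ^ 2 = k ^ 2 := by rw [hk]; ring
  rw [e0'] at e0
  have c1 := sub_mul_psiAP_le a hx0.le (by linarith : 0 ≤ x + k)
  have c2 := sub_mul_psiAP_le a hx0.le (by linarith : 0 ≤ x - k)
  rw [← hk]
  rw [abs_le] at e0 ep em ⊢
  have hck : 0 ≤ c * k ^ 2 := by positivity
  constructor
  · refine le_of_mul_le_mul_left ?_ hk0
    linarith [e0.1, em.2]
  · refine le_of_mul_le_mul_left ?_ hk0
    linarith [e0.1, ep.2]

/-- The primes `p ≤ x` with `p ≡ a` modulo `q`. -/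
noncomputable def primesAP {q : ℕ} (a : ZMod q) (x : ℝ) : Finset ℕ :=
  (Finset.Ioc 0 ⌊x⌋₊).filter fun p => p.Prime ∧ (p : ZMod q) = a

/-- The Chebyshev function `θ(x; q, a)`. -/
noncomputable def thetaAP {q : ℕ} (a : ZMod q) (x : ℝ) : ℝ := ∑ p ∈ primesAP a x, Real.log p

lemma primesAP_subset {q : ℕ} (a : ZMod q) (x : ℝ) :
    primesAP a x ⊆ (Finset.Ioc 0 ⌊x⌋₊).filter Nat.Prime := by
  intro p hp
  simp only [primesAP, Finset.mem_filter] at hp ⊢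
  exact ⟨hp.1, hp.2.1⟩

lemma psiAP_sub_thetaAP {q : ℕ} (a : ZMod q) (x : ℝ) :
    psiAP a x - thetaAP a x
      = ∑ n ∈ Finset.Ioc 0 ⌊x⌋₊ with ¬ n.Prime, residueClass a n := by
  rw [psiAP, thetaAP, primesAP, Finset.sum_filter, Finset.sum_filter,
    show Finset.Icc 1 ⌊x⌋₊ = Finset.Ioc 0 ⌊x⌋₊ from rfl, ← Finset.sum_sub_distrib]
  refine Finset.sum_congr rfl fun n _ => ?_
  by_cases hn : n.Prime
  · by_cases h : (n : ZMod q) = a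
    · simp [hn, h, residueClass, ArithmeticFunction.vonMangoldt_apply_prime]
    · simp [hn, h, residueClass]
  · simp [hn]

lemma abs_psiAP_sub_thetaAP_le {q : ℕ} (a : ZMod q) (x : ℝ) :
    |psiAP a x - thetaAP a x| ≤ Chebyshev.psi x - Chebyshev.theta x := by
  rw [psiAP_sub_thetaAP, Chebyshev.psi_sub_theta_eq_sum_not_prime,
    abs_of_nonneg (Finset.sum_nonneg fun n _ => residueClass_nonneg a n)]
  exact Finset.sum_le_sum fun n _ => residueClass_le a n

lemma abs_card_primesAP_sub_le {q : ℕ} (a : ZMod q) {x : ℝ} (hx : 1 < x) :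
    |(primesAP a x).card - thetaAP a x / Real.log x|
      ≤ Nat.primeCounting ⌊x⌋₊ - Chebyshev.theta x / Real.log x := by
  have hlog : 0 < Real.log x := Real.log_pos hx
  have hp : ∀ p ∈ (Finset.Ioc 0 ⌊x⌋₊).filter Nat.Prime, 0 ≤ 1 - Real.log p / Real.log x := by
    intro p hp
    rw [Finset.mem_filter, Finset.mem_Ioc] at hp
    rw [sub_nonneg, div_le_one hlog]
    exact Real.log_le_log (by exact_mod_cast hp.1.1) ((Nat.le_floor_iff (by linarith)).1 hp.1.2)
  have h1 : (primesAP a x).card - thetaAP a x / Real.log x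
      = ∑ p ∈ primesAP a x, (1 - Real.log p / Real.log x) := by
    rw [Finset.sum_sub_distrib, thetaAP, Finset.sum_div]
    simp
  have h2 : Nat.primeCounting ⌊x⌋₊ - Chebyshev.theta x / Real.log x
      = ∑ p ∈ (Finset.Ioc 0 ⌊x⌋₊).filter Nat.Prime, (1 - Real.log p / Real.log x) := by
    rw [Finset.sum_sub_distrib, Chebyshev.theta, Finset.sum_div]
    congr 1
    rw [Finset.sum_const, nsmul_one, Nat.primeCounting, Nat.primeCounting',
      Nat.count_eq_card_filter_range]
    congr 2
    ext p
    simp only [Finset.mem_filter, Finset.mem_range, Finset.mem_Ioc]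
    exact ⟨fun h => ⟨⟨h.2.pos, by omega⟩, h.2⟩, fun h => ⟨by omega, h.2⟩⟩
  rw [h1, h2, abs_of_nonneg (Finset.sum_nonneg fun p h => hp p (primesAP_subset a x h))]
  exact Finset.sum_le_sum_of_subset_of_nonneg (primesAP_subset a x) fun p h _ => hp p h

/-- The prime number theorem in arithmetic progressions, with one factor `log x` saved. -/
theorem card_primesAP_isBigO {q : ℕ} [NeZero q] {a : ZMod q} (ha : IsUnit a) :
    (fun x : ℝ => (primesAP a x).card - (q.totient : ℝ)⁻¹ * (x / Real.log x))
      =O[atTop] fun x : ℝ => x / Real.log x ^ 2 := by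
  have h1 : (fun x : ℝ => (primesAP a x).card - thetaAP a x / Real.log x)
      =O[atTop] fun x : ℝ => x / Real.log x ^ 2 := by
    refine (IsBigO.of_bound 1 ?_).trans Chebyshev.primeCounting_sub_theta_div_log_isBigO
    filter_upwards [eventually_gt_atTop 1] with x hx
    rw [Real.norm_eq_abs, Real.norm_eq_abs, one_mul]
    exact (abs_card_primesAP_sub_le a hx).trans (le_abs_self _)
  have hl : (fun x : ℝ => (psiAP a x - thetaAP a x) / Real.log x)
      =O[atTop] fun x : ℝ => x / Real.log x ^ 2 := by
    obtain ⟨C, hC⟩ := Chebyshev.psi_sub_theta_le_mul_sqrt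
    refine IsBigO.of_bound (2 * C) ?_
    filter_upwards [eventually_gt_atTop 1] with x hx
    have hx0 : 0 < x := by linarith
    have hlog : 0 < Real.log x := Real.log_pos hx
    have hs : Real.log x ≤ 2 * √x := by
      have := Real.log_le_sub_one_of_pos (Real.sqrt_pos.2 hx0)
      rw [Real.log_sqrt hx0.le] at this
      linarith
    have h := (abs_psiAP_sub_thetaAP_le a x).trans (hC x)
    have hC0 : 0 ≤ C := by
      have := (abs_nonneg _).trans h
      exact nonneg_of_mul_nonneg_left this (Real.sqrt_pos.2 hx0)
    rw [Real.norm_eq_abs, Real.norm_eq_abs, abs_div, abs_of_pos hlog,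
      abs_of_pos (by positivity : 0 < x / Real.log x ^ 2)]
    calc _ ≤ C * √x / Real.log x := by gcongr
      _ = C * √x * Real.log x / Real.log x ^ 2 := by field_simp
      _ ≤ C * √x * (2 * √x) / Real.log x ^ 2 := by gcongr
      _ = 2 * C * (√x * √x / Real.log x ^ 2) := by ring
      _ = _ := by rw [Real.mul_self_sqrt hx0.le]
  have h3 : (fun x : ℝ => (psiAP a x - (q.totient : ℝ)⁻¹ * x) / Real.log x)
      =O[atTop] fun x : ℝ => x / Real.log x ^ 2 := by
    obtain ⟨C, -, hC⟩ := abs_psiAP_sub_le ha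
    refine IsBigO.of_bound C ?_
    filter_upwards [eventually_ge_atTop (Real.exp 4)] with x hx
    have hx1 : 1 < x := lt_of_lt_of_le (by simp) hx
    have hlog : 0 < Real.log x := Real.log_pos hx1
    rw [Real.norm_eq_abs, Real.norm_eq_abs, abs_div, abs_of_pos hlog,
      abs_of_pos (by positivity : 0 < x / Real.log x ^ 2)]
    calc _ ≤ C * (x / Real.log x) / Real.log x := by gcongr; exact hC x hx
      _ = _ := by field_simp
  refine ((h1.sub hl).add h3).congr_left fun x => ?_
  ring

/-- The contribution of the `k`-th powers to `R(x, q, a)`. -/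
noncomputable def powerPart {q : ℕ} (a : ZMod q) (k : ℕ) (x : ℝ) : ℝ :=
  ∑ p ∈ Finset.Ioc 0 ⌊x⌋₊,
    if p.Prime ∧ (p : ℝ) ^ k ≤ x ∧ (p : ZMod q) ^ k = a then (1 : ℝ) / k else 0

lemma powerPart_nonneg {q : ℕ} (a : ZMod q) (k : ℕ) (x : ℝ) : 0 ≤ powerPart a k x :=
  Finset.sum_nonneg fun p _ => by split_ifs <;> positivity

lemma Rqa_eq_sum_powerPart {q : ℕ} (a : ZMod q) {x : ℝ} (hx : 1 ≤ x) :
    Rqa q a x = ∑ k ∈ Finset.Icc 2 ⌊2 * Real.log x⌋₊, powerPart a k x := by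
  have hx0 : 0 ≤ x := by linarith
  have hk : ∀ p k : ℕ, p.Prime → (p : ℝ) ^ k ≤ x → k ≤ ⌊2 * Real.log x⌋₊ := by
    intro p k hp h
    refine Nat.le_floor ?_
    have h2 : (2 : ℝ) ^ k ≤ x := le_trans (by gcongr; exact_mod_cast hp.two_le) h
    have h3 := Real.log_le_log (by positivity) h2
    rw [Real.log_pow] at h3
    nlinarith [Real.log_two_gt_d9, (Nat.cast_nonneg k : (0 : ℝ) ≤ k)]
  have hp : ∀ p k : ℕ, p.Prime → 2 ≤ k → (p : ℝ) ^ k ≤ x → p ∈ Finset.Ioc 0 ⌊x⌋₊ := by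
    intro p k hp hk h
    rw [Finset.mem_Ioc, Nat.le_floor_iff hx0]
    refine ⟨hp.pos, le_trans ?_ h⟩
    exact le_self_pow₀ (by exact_mod_cast hp.one_le) (by omega)
  have hin : ∀ p : ℕ, (∑' k : ℕ,
      if p.Prime ∧ 2 ≤ k ∧ (p : ℝ) ^ k ≤ x ∧ (p : ZMod q) ^ k = a then (1 : ℝ) / k else 0)
      = ∑ k ∈ Finset.Icc 2 ⌊2 * Real.log x⌋₊,
        if p.Prime ∧ 2 ≤ k ∧ (p : ℝ) ^ k ≤ x ∧ (p : ZMod q) ^ k = a then (1 : ℝ) / k else 0 := by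
    intro p
    refine tsum_eq_sum fun k hk' => if_neg fun h => hk' ?_
    exact Finset.mem_Icc.2 ⟨h.2.1, hk p k h.1 h.2.2.1⟩
  rw [Rqa, tsum_eq_sum (s := Finset.Ioc 0 ⌊x⌋₊)]
  · simp_rw [hin]
    rw [Finset.sum_comm]
    refine Finset.sum_congr rfl fun k hk' => ?_
    rw [Finset.mem_Icc] at hk'
    simp [powerPart, hk'.1]
  · intro p hp'
    rw [hin]
    exact Finset.sum_eq_zero fun k _ => if_neg fun h => hp' (hp p k h.1 h.2.1 h.2.2.1)

lemma powerPart_le {q : ℕ} (a : ZMod q) {k : ℕ} (hk : 3 ≤ k) {x : ℝ} (hx : 0 ≤ x) :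
    powerPart a k x ≤ x ^ (1 / 3 : ℝ) := by
  have hsub : (Finset.Ioc 0 ⌊x⌋₊).filter (fun p : ℕ =>
      p.Prime ∧ (p : ℝ) ^ k ≤ x ∧ (p : ZMod q) ^ k = a) ⊆ Finset.Ioc 0 ⌊x ^ (1 / 3 : ℝ)⌋₊ := by
    intro p hp
    rw [Finset.mem_filter] at hp
    rw [Finset.mem_Ioc]
    refine ⟨hp.2.1.pos, Nat.le_floor ?_⟩
    have h3 : (p : ℝ) ^ 3 ≤ x :=
      (pow_le_pow_right₀ (by exact_mod_cast hp.2.1.one_le) hk).trans hp.2.2.1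
    calc (p : ℝ) = ((p : ℝ) ^ (3 : ℕ)) ^ (1 / 3 : ℝ) := by
          rw [← Real.rpow_natCast, ← Real.rpow_mul (by positivity)]; norm_num
      _ ≤ _ := by gcongr
  have hcard := Finset.card_le_card hsub
  rw [Nat.card_Ioc, Nat.sub_zero] at hcard
  rw [powerPart, ← Finset.sum_filter, Finset.sum_const, nsmul_eq_mul]
  calc _ ≤ (⌊x ^ (1 / 3 : ℝ)⌋₊ : ℝ) * 1 := by
        gcongr
        rw [div_le_one (by positivity)]
        exact_mod_cast (by omega : 1 ≤ k)
    _ ≤ _ := by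
        rw [mul_one]
        exact Nat.floor_le (by positivity)

lemma powerPart_two {q : ℕ} [NeZero q] (a : ZMod q) {x : ℝ} (hx : 1 ≤ x) :
    powerPart a 2 x
      = ∑ b ∈ Finset.univ.filter (fun b : ZMod q => b ^ 2 = a), ((primesAP b √x).card : ℝ) / 2 := by
  have hx0 : 0 ≤ x := by linarith
  obtain ⟨S, hS⟩ : ∃ S, S = (Finset.Ioc 0 ⌊x⌋₊).filter (fun p : ℕ =>
      p.Prime ∧ (p : ℝ) ^ 2 ≤ x ∧ (p : ZMod q) ^ 2 = a) := ⟨_, rfl⟩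
  have hmaps : ∀ p ∈ S, (p : ZMod q) ∈ Finset.univ.filter (fun b : ZMod q => b ^ 2 = a) := by
    intro p hp
    rw [hS, Finset.mem_filter] at hp
    simpa using hp.2.2.2
  rw [powerPart, ← Finset.sum_filter, ← hS, Finset.sum_const, nsmul_eq_mul,
    Finset.card_eq_sum_card_fiberwise hmaps, ← Finset.sum_div, Nat.cast_sum, mul_one_div]
  norm_num
  refine Finset.sum_congr rfl fun b hb => ?_
  congr 2
  ext p
  rw [Finset.mem_filter] at hb
  simp only [hS, primesAP, Finset.mem_filter, Finset.mem_Ioc, Nat.le_floor_iff hx0,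
    Nat.le_floor_iff (Real.sqrt_nonneg x)]
  constructor
  · rintro ⟨⟨⟨h1, -⟩, h2, h3, -⟩, h4⟩
    exact ⟨⟨h1, Real.le_sqrt_of_sq_le h3⟩, h2, h4⟩
  · rintro ⟨⟨h1, h2⟩, h3, h4⟩
    have h5 : (p : ℝ) ^ 2 ≤ x := (Real.le_sqrt (by positivity) hx0).1 h2
    refine ⟨⟨⟨h1, le_trans ?_ h5⟩, h3, h5, by rw [h4, hb.2]⟩, h4⟩
    exact le_self_pow₀ (by exact_mod_cast h3.one_le) two_ne_zero

lemma rpow_third_mul_log_isBigO :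
    (fun x : ℝ => x ^ (1 / 3 : ℝ) * (2 * Real.log x))
      =O[atTop] fun x : ℝ => √x / Real.log x ^ 2 := by
  have h := (isLittleO_log_rpow_rpow_atTop 3 (by norm_num : (0 : ℝ) < 1 / 6)).isBigO
  have h2 := ((isBigO_refl (fun x : ℝ => 2 * (x ^ (1 / 3 : ℝ) / Real.log x ^ 2)) atTop).mul h)
  refine (h2.trans (IsBigO.of_bound 2 ?_)).congr' ?_ EventuallyEq.rfl
  · filter_upwards [eventually_gt_atTop 1] with x hx
    have hx0 : 0 < x := by linarith
    have : x ^ (1 / 3 : ℝ) * x ^ (1 / 6 : ℝ) = √x := by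
      rw [← Real.rpow_add hx0, Real.sqrt_eq_rpow]; norm_num
    rw [← this, ← Real.norm_of_nonneg (zero_le_two (α := ℝ)), ← norm_mul,
      Real.norm_of_nonneg (zero_le_two (α := ℝ))]
    apply le_of_eq
    congr 1
    ring
  · filter_upwards [eventually_gt_atTop 1] with x hx
    have hlog : 0 < Real.log x := Real.log_pos hx
    rw [show (3 : ℝ) = (3 : ℕ) by norm_num, Real.rpow_natCast]
    field_simp

lemma card_primesAP_sqrt_isBigO {q : ℕ} [NeZero q] {b : ZMod q} (hb : IsUnit b) :
    (fun x : ℝ => ((primesAP b √x).card : ℝ) / 2 - (q.totient : ℝ)⁻¹ * (√x / Real.log x))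
      =O[atTop] fun x : ℝ => √x / Real.log x ^ 2 := by
  have h := ((card_primesAP_isBigO hb).comp_tendsto Real.tendsto_sqrt_atTop).const_mul_left (1 / 2)
  refine (h.congr' ?_ EventuallyEq.rfl).trans (IsBigO.of_bound 4 ?_)
  · filter_upwards [eventually_ge_atTop 0] with x hx
    simp only [Function.comp_apply, Real.log_sqrt hx]
    field_simp
  · filter_upwards [eventually_ge_atTop 0] with x hx
    rw [Function.comp_apply, Real.log_sqrt hx, Real.norm_of_nonneg (by positivity),
      Real.norm_of_nonneg (by positivity)]
    apply le_of_eq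
    field_simp
    norm_num

theorem Rqa_isBigO {q : ℕ} [NeZero q] {a : ZMod q} (ha : IsUnit a) :
    (fun x : ℝ => Rqa q a x
        - (q.totient : ℝ)⁻¹ * (Set.ncard {b : ZMod q | b ^ 2 = a} : ℝ) * (√x / Real.log x))
      =O[atTop] fun x : ℝ => √x / Real.log x ^ 2 := by
  have h1 : (fun x : ℝ => ∑ b ∈ Finset.univ.filter (fun b : ZMod q => b ^ 2 = a),
      (((primesAP b √x).card : ℝ) / 2 - (q.totient : ℝ)⁻¹ * (√x / Real.log x)))
      =O[atTop] fun x : ℝ => √x / Real.log x ^ 2 := by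
    refine IsBigO.fun_sum fun b hb => card_primesAP_sqrt_isBigO ?_
    rw [Finset.mem_filter] at hb
    exact (isUnit_pow_iff two_ne_zero).1 (hb.2 ▸ ha)
  have h2 : (fun x : ℝ => Rqa q a x - powerPart a 2 x)
      =O[atTop] fun x : ℝ => √x / Real.log x ^ 2 := by
    refine (IsBigO.of_bound 1 ?_).trans rpow_third_mul_log_isBigO
    filter_upwards [eventually_ge_atTop (Real.exp 1)] with x hx
    have hx1 : 1 ≤ x := le_trans (by simp) hx
    have hlog : 1 ≤ Real.log x := by rwa [Real.le_log_iff_exp_le (by linarith)]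
    have hfl : 2 ≤ ⌊2 * Real.log x⌋₊ := Nat.le_floor (by push_cast; linarith)
    rw [Rqa_eq_sum_powerPart a hx1, ← Finset.add_sum_Ioc_eq_sum_Icc hfl, add_sub_cancel_left,
      one_mul, Real.norm_of_nonneg (Finset.sum_nonneg fun k _ => powerPart_nonneg a k x),
      Real.norm_of_nonneg (by positivity)]
    calc _ ≤ ∑ k ∈ Finset.Ioc 2 ⌊2 * Real.log x⌋₊, x ^ (1 / 3 : ℝ) :=
          Finset.sum_le_sum fun k hk => powerPart_le a (Finset.mem_Ioc.1 hk).1 (by linarith)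
      _ = x ^ (1 / 3 : ℝ) * ((⌊2 * Real.log x⌋₊ - 2 : ℕ) : ℝ) := by simp [mul_comm]
      _ ≤ _ := by
          gcongr
          exact le_trans (by exact_mod_cast Nat.sub_le _ _) (Nat.floor_le (by positivity))
  refine (h2.add h1).congr' ?_ EventuallyEq.rfl
  filter_upwards [eventually_ge_atTop 1] with x hx
  have hn : Set.ncard {b : ZMod q | b ^ 2 = a}
      = (Finset.univ.filter (fun b : ZMod q => b ^ 2 = a)).card := by
    rw [← Set.ncard_coe_finset]
    simp
  rw [Finset.sum_sub_distrib, ← powerPart_two a hx, hn, Finset.sum_const, nsmul_eq_mul]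
  ring

end PrimesAP

/-- For distinct invertible residues `a₁, …, a_r mod q`,
`Σ_j R(x,q,a_j) = κ·x^{1/2}/log x + O(x^{1/2}/(log x)²)` where
`κ = (1/φ(q))·Σ_j #{b mod q : b² = a_j}`. -/
theorem sum_Rqa_asymptotic (q : ℕ) (hq : 0 < q) (r : ℕ)
    (a : Fin r → ZMod q) (ha : Function.Injective a) (haq : ∀ j, IsUnit (a j)) :
    (fun x : ℝ => (∑ j, Rqa q (a j) x)
        - ((1 / (Nat.totient q : ℝ)) * ∑ j, (Set.ncard {b : ZMod q | b ^ 2 = a j} : ℝ))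
          * Real.sqrt x / Real.log x)
      =O[atTop] (fun x : ℝ => Real.sqrt x / (Real.log x) ^ 2) := by
  have : NeZero q := ⟨hq.ne'⟩
  refine (IsBigO.fun_sum (s := Finset.univ) fun j _ => PrimesAP.Rqa_isBigO (haq j)).congr_left
    fun x => ?_
  rw [Finset.sum_sub_distrib, ← Finset.sum_mul, ← Finset.mul_sum]
  ring
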